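/- arXiv:1707.07963 — 5 statements merged into one kernel-verified Lean document; each statement's English description precedes it below -/
import Mathlib

section
/- For every β > 0 and δ' > 0 there exists C > 0 such that for all h ∈ (0, 1] and all x ∈ [−δ', 0] one has ∫_{−2δ'}^{0} e^{−β|x² − t²|/h} dt ≤ C h^{1/2}. -/
/-- For every `β > 0` and `δ' > 0` there exists `C > 0` such that for all `h ∈ (0,1]`
and all `x ∈ [−δ', 0]` one has `∫_{−2δ'}^{0} exp(−β|x² − t²|/h) dt ≤ C h^{1/2}`. -/
theorem gaussian_type_integral_bound :
    ∀ β > (0 : ℝ), ∀ δ' > (0 : ℝ), ∃ C > (0 : ℝ),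
      ∀ h ∈ Set.Ioc (0 : ℝ) 1, ∀ x ∈ Set.Icc (-δ') (0 : ℝ),
        (∫ t in (-2 * δ')..(0 : ℝ), Real.exp (-β * |x ^ 2 - t ^ 2| / h)) ≤
          C * h ^ ((1 : ℝ) / 2) := by
  intro β hβ δ hδ
  refine ⟨√(Real.pi / β), Real.sqrt_pos.2 (by positivity), ?_⟩
  rintro h ⟨hh, -⟩ x ⟨-, hx⟩
  have hb : 0 < β / h := by positivity
  have hint : MeasureTheory.Integrable (fun t : ℝ => Real.exp (-(β / h) * (t - x) ^ 2)) :=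
    (integrable_exp_neg_mul_sq hb).comp_sub_right x
  have hab : -2 * δ ≤ 0 := by linarith
  calc (∫ t in (-2 * δ)..(0 : ℝ), Real.exp (-β * |x ^ 2 - t ^ 2| / h))
      ≤ ∫ t in (-2 * δ)..(0 : ℝ), Real.exp (-(β / h) * (t - x) ^ 2) := by
        apply intervalIntegral.integral_mono_on hab
        · apply Continuous.intervalIntegrable
          fun_prop
        · exact hint.intervalIntegrable
        · rintro t ⟨-, ht⟩
          apply Real.exp_le_exp.2
          have key : (t - x) ^ 2 ≤ |x ^ 2 - t ^ 2| := by
            rcases le_total t x with h1 | h1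
            · rw [abs_sub_comm]
              refine le_trans ?_ (le_abs_self _)
              nlinarith
            · refine le_trans ?_ (le_abs_self _)
              nlinarith
          have := mul_le_mul_of_nonneg_left key hb.le
          have e : -β * |x ^ 2 - t ^ 2| / h = -(β / h * |x ^ 2 - t ^ 2|) := by ring
          rw [e]
          linarith
    _ ≤ ∫ t : ℝ, Real.exp (-(β / h) * (t - x) ^ 2) := by
        rw [intervalIntegral.integral_of_le hab]
        exact MeasureTheory.setIntegral_le_integral hint
          (Filter.Eventually.of_forall fun t => (Real.exp_pos _).le)
    _ = √(Real.pi / (β / h)) := by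
        rw [MeasureTheory.integral_sub_right_eq_self
          (fun t : ℝ => Real.exp (-(β / h) * t ^ 2)) x, integral_gaussian]
    _ = √(Real.pi / β) * h ^ ((1 : ℝ) / 2) := by
        rw [← Real.sqrt_eq_rpow, ← Real.sqrt_mul (by positivity)]
        congr 1
        field_simp
end

section
/- For all β > 0, h > 0, L > 0 and all x ∈ [−L, 0] one has the two inequalities: ∫_{x}^{0} e^{−β|x² − t²|/h} dt ≤ ∫_{0}^{−x} e^{−βt²/h} dt, and ∫_{−L}^{x} e^{−β|x² − t²|/h} dt ≤ ∫_{−L−x}^{0} e^{−βt²/h} dt. In particular ∫_{−L}^{0} e^{−β|x² − t²|/h} dt ≤ 2∫_{0}^{+∞} e^{−βt²/h} dt = √(πh/β). -/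
/-- For all `β, h, L > 0` and `x ∈ [−L, 0]`:
`∫_x^0 e^{−β|x²−t²|/h} dt ≤ ∫_0^{−x} e^{−βt²/h} dt`,
`∫_{−L}^x e^{−β|x²−t²|/h} dt ≤ ∫_{−L−x}^0 e^{−βt²/h} dt`, and in particular
`∫_{−L}^0 e^{−β|x²−t²|/h} dt ≤ 2∫_0^∞ e^{−βt²/h} dt = √(πh/β)`. -/
theorem gaussian_type_integral_inequalities
    (β h L : ℝ) (hβ : 0 < β) (hh : 0 < h) (hL : 0 < L)
    (x : ℝ) (hx : x ∈ Set.Icc (-L) (0 : ℝ)) :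
    ((∫ t in x..(0 : ℝ), Real.exp (-β * |x ^ 2 - t ^ 2| / h)) ≤
      ∫ t in (0 : ℝ)..(-x), Real.exp (-β * t ^ 2 / h)) ∧
    ((∫ t in (-L)..x, Real.exp (-β * |x ^ 2 - t ^ 2| / h)) ≤
      ∫ t in (-L - x)..(0 : ℝ), Real.exp (-β * t ^ 2 / h)) ∧
    ((∫ t in (-L)..(0 : ℝ), Real.exp (-β * |x ^ 2 - t ^ 2| / h)) ≤
      2 * ∫ t in Set.Ioi (0 : ℝ), Real.exp (-β * t ^ 2 / h)) ∧
    (2 * ∫ t in Set.Ioi (0 : ℝ), Real.exp (-β * t ^ 2 / h)) = Real.sqrt (Real.pi * h / β) := by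
  obtain ⟨hx1, hx2⟩ := hx
  have hmono : ∀ s : ℝ, s ^ 2 ≤ |x ^ 2 - (s + x) ^ 2| →
      Real.exp (-β * |x ^ 2 - (s + x) ^ 2| / h) ≤ Real.exp (-β * s ^ 2 / h) := by
    intro s hs
    apply Real.exp_le_exp.mpr
    apply div_le_div_of_nonneg_right _ hh.le
    nlinarith
  have hcf : Continuous (fun t : ℝ => Real.exp (-β * |x ^ 2 - t ^ 2| / h)) := by fun_prop
  have hcf' : Continuous (fun t : ℝ => Real.exp (-β * |x ^ 2 - (t + x) ^ 2| / h)) := by fun_prop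
  have hcg : Continuous (fun t : ℝ => Real.exp (-β * t ^ 2 / h)) := by fun_prop
  have h1 : (∫ t in x..(0 : ℝ), Real.exp (-β * |x ^ 2 - t ^ 2| / h)) ≤
      ∫ t in (0 : ℝ)..(-x), Real.exp (-β * t ^ 2 / h) := by
    have e := intervalIntegral.integral_comp_add_right (a := 0) (b := -x)
      (fun t : ℝ => Real.exp (-β * |x ^ 2 - t ^ 2| / h)) x
    rw [zero_add, neg_add_cancel] at e
    rw [← e]
    apply intervalIntegral.integral_mono_on (by linarith) (hcf'.intervalIntegrable _ _)
      (hcg.intervalIntegrable _ _)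
    intro s hs
    apply hmono
    refine le_trans ?_ (le_abs_self _)
    nlinarith [hs.1, hs.2, mul_nonneg hs.1 (sub_nonneg.mpr hs.2)]
  have h2 : (∫ t in (-L)..x, Real.exp (-β * |x ^ 2 - t ^ 2| / h)) ≤
      ∫ t in (-L - x)..(0 : ℝ), Real.exp (-β * t ^ 2 / h) := by
    have e := intervalIntegral.integral_comp_add_right (a := -L - x) (b := 0)
      (fun t : ℝ => Real.exp (-β * |x ^ 2 - t ^ 2| / h)) x
    rw [zero_add, sub_add_cancel] at e
    rw [← e]
    apply intervalIntegral.integral_mono_on (by linarith) (hcf'.intervalIntegrable _ _)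
      (hcg.intervalIntegrable _ _)
    intro s hs
    apply hmono
    refine le_trans ?_ (neg_le_abs _)
    nlinarith [mul_nonneg_of_nonpos_of_nonpos hs.2 hx2]
  have hfun : (fun t : ℝ => Real.exp (-β * t ^ 2 / h))
      = fun t : ℝ => Real.exp (-(β / h) * t ^ 2) := by
    funext t
    congr 1
    ring
  have hint : MeasureTheory.Integrable (fun t : ℝ => Real.exp (-β * t ^ 2 / h)) := by
    rw [hfun]
    exact integrable_exp_neg_mul_sq (div_pos hβ hh)
  have hle : ∀ a : ℝ, 0 ≤ a → (∫ t in (0 : ℝ)..a, Real.exp (-β * t ^ 2 / h)) ≤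
      ∫ t in Set.Ioi (0 : ℝ), Real.exp (-β * t ^ 2 / h) := by
    intro a ha
    rw [intervalIntegral.integral_of_le ha]
    apply MeasureTheory.setIntegral_mono_set hint.integrableOn
    · exact Filter.Eventually.of_forall fun t => (Real.exp_pos _).le
    · exact Set.Ioc_subset_Ioi_self.eventuallyLE
  refine ⟨h1, h2, ?_, ?_⟩
  · rw [← intervalIntegral.integral_add_adjacent_intervals (hcf.intervalIntegrable (-L) x)
      (hcf.intervalIntegrable x 0)]
    have e := intervalIntegral.integral_comp_neg (a := 0) (b := L + x)
      (fun t : ℝ => Real.exp (-β * t ^ 2 / h))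
    simp only [neg_sq, neg_zero] at e
    have e2 : -(L + x) = -L - x := by ring
    rw [e2] at e
    have a1 := hle (-x) (by linarith)
    have a2 := hle (L + x) (by linarith)
    linarith
  · rw [hfun, integral_gaussian_Ioi]
    have : Real.pi / (β / h) = Real.pi * h / β := by field_simp
    rw [this]
    ring
end

section
/- Let Ĩ = [E'−d', E'+d'] ⊂ ℝ, Ω ⊂ ℂ an open neighborhood of Ĩ, and 𝒜 holomorphic on Ω, real-valued on Ω ∩ ℝ, with m ≤ 𝒜'(E) ≤ M on Ĩ, m > 0. Fix C > 0 and δ > 0. Then there exist C₀'' > 0 and h₀ > 0 such that the following holds for every h ∈ (0, h₀]: let f be holomorphic on Ω, real-valued on Ω ∩ ℝ, with sup_Ω |f| ≤ C h^{1/2}; let ẽ ∈ [E'−d'+δ, E'+d'−δ] be a real zero of z ↦ cos(𝒜(z)/h) + f(z); and let F be holomorphic on Ω with 0 < N := sup_Ω |F| ≤ 1. Then the equation cos(𝒜(z)/h) + f(z) = hF(z) has exactly one solution E in the open disk B(ẽ, C₀'' h² N), and this solution satisfies |E − ẽ + h²F(E)/(𝒜'(ẽ)·sin(𝒜(ẽ)/h))|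 ≤ C₀'' h^{5/2} N. -/
theorem aux_cauchy (G : ℂ → ℂ) (c : ℂ) (R B : ℝ) (hR : 0 < R)
    (hG : DifferentiableOn ℂ G (Metric.ball c R)) (hB : ∀ z ∈ Metric.ball c R, ‖G z‖ ≤ B)
    (z : ℂ) (hz : z ∈ Metric.ball c (R / 2)) : ‖deriv G z‖ ≤ B / (R / 2) := by
  have hsub : Metric.closedBall z (R / 2) ⊆ Metric.ball c R := by
    intro w hw
    rw [Metric.mem_closedBall] at hw
    rw [Metric.mem_ball] at hz ⊢
    have := dist_triangle w z c
    linarith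
  apply Complex.norm_deriv_le_of_forall_mem_sphere_norm_le (by positivity)
  · exact (hG.mono hsub).diffContOnCl_ball subset_rfl
  · intro w hw
    exact hB w (hsub (Metric.sphere_subset_closedBall hw))

theorem aux_cos (t : ℂ) (ht : ‖t‖ ≤ 1) : ‖Complex.cos t - 1‖ ≤ 2 * ‖t‖ := by
  have h1 := Complex.norm_exp_sub_one_le (x := t * Complex.I) (by simpa using ht)
  have h2 := Complex.norm_exp_sub_one_le (x := -t * Complex.I) (by simpa using ht)
  simp only [norm_mul, norm_neg, Complex.norm_I, mul_one] at h1 h2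
  have : Complex.cos t - 1 = ((Complex.exp (t * Complex.I) - 1)
      + (Complex.exp (-t * Complex.I) - 1)) / 2 := by
    rw [Complex.cos]; ring
  rw [this, norm_div, Complex.norm_ofNat]
  have := norm_add_le (Complex.exp (t * Complex.I) - 1) (Complex.exp (-t * Complex.I) - 1)
  linarith

theorem aux_sin (t : ℂ) (ht : ‖t‖ ≤ 1) : ‖Complex.sin t‖ ≤ 2 * ‖t‖ := by
  have h1 := Complex.norm_exp_sub_one_le (x := t * Complex.I) (by simpa using ht)
  have h2 := Complex.norm_exp_sub_one_le (x := -t * Complex.I) (by simpa using ht)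
  simp only [norm_mul, norm_neg, Complex.norm_I, mul_one] at h1 h2
  have : Complex.sin t = ((Complex.exp (-t * Complex.I) - 1)
      - (Complex.exp (t * Complex.I) - 1)) * Complex.I / 2 := by
    rw [Complex.sin]; ring
  rw [this, norm_div, Complex.norm_ofNat, norm_mul, Complex.norm_I, mul_one]
  have := norm_sub_le (Complex.exp (-t * Complex.I) - 1) (Complex.exp (t * Complex.I) - 1)
  linarith

theorem aux_sin_sub (x : ℝ) (w : ℂ) (hw : ‖w - x‖ ≤ 1) :
    ‖Complex.sin w - Complex.sin x‖ ≤ 4 * ‖w - x‖ := by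
  have e1 : Complex.sin w - Complex.sin x =
      Complex.sin x * (Complex.cos (w - x) - 1) + Complex.cos x * Complex.sin (w - x) := by
    have : w = x + (w - x) := by ring
    conv_lhs => rw [this, Complex.sin_add]
    ring
  have hs : ‖Complex.sin x‖ ≤ 1 := by
    rw [← Complex.ofReal_sin, Complex.norm_real]; exact Real.abs_sin_le_one x
  have hc : ‖Complex.cos x‖ ≤ 1 := by
    rw [← Complex.ofReal_cos, Complex.norm_real]; exact Real.abs_cos_le_one x
  have h1 := aux_cos _ hw
  have h2 := aux_sin _ hw
  rw [e1]
  calc _ ≤ ‖Complex.sin x‖ * ‖Complex.cos (w - x) - 1‖ + ‖Complex.cos x‖ * ‖Complex.sin (w - x)‖ := by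
        rw [← norm_mul, ← norm_mul]; exact norm_add_le _ _
    _ ≤ 1 * (2 * ‖w - x‖) + 1 * (2 * ‖w - x‖) := by gcongr
    _ = _ := by ring

theorem aux_root (g : ℂ → ℂ) (e L : ℂ) (ρ c : ℝ) (hρ : 0 < ρ) (hL : L ≠ 0)
    (hc : c ≤ ‖L‖ / 4) (hge : ‖g e‖ ≤ ‖L‖ * ρ / 4)
    (hg : ∀ x ∈ Metric.ball e ρ, ∀ y ∈ Metric.ball e ρ, ‖g x - g y - L * (x - y)‖ ≤ c * ‖x - y‖) :
    ∃ E ∈ Metric.ball e ρ, g E = 0 ∧ ∀ E₂ ∈ Metric.ball e ρ, g E₂ = 0 → E₂ = E := by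
  have hLp : 0 < ‖L‖ := norm_pos_iff.2 hL
  set T : ℂ → ℂ := fun x => x - g x / L with hT
  have hTl : ∀ x ∈ Metric.ball e ρ, ∀ y ∈ Metric.ball e ρ, ‖T x - T y‖ ≤ 1 / 4 * ‖x - y‖ := by
    intro x hx y hy
    have : T x - T y = - (g x - g y - L * (x - y)) / L := by
      simp only [hT]; field_simp; ring
    rw [this, norm_div, norm_neg, div_le_iff₀ hLp]
    refine (hg x hx y hy).trans ?_
    have := mul_le_mul_of_nonneg_right hc (norm_nonneg (x - y))
    linarith
  have hsub : Metric.closedBall e (ρ / 2) ⊆ Metric.ball e ρ :=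
    Metric.closedBall_subset_ball (by linarith)
  have hee : e ∈ Metric.ball e ρ := Metric.mem_ball_self hρ
  have hTe : ‖T e - e‖ ≤ ρ / 4 := by
    have : T e - e = - (g e / L) := by simp only [hT]; ring
    rw [this, norm_neg, norm_div, div_le_iff₀ hLp]
    linarith
  have hmaps : Set.MapsTo T (Metric.closedBall e (ρ / 2)) (Metric.closedBall e (ρ / 2)) := by
    intro x hx
    have h1 := hTl x (hsub hx) e hee
    rw [Metric.mem_closedBall, dist_eq_norm] at hx ⊢
    have : T x - e = (T x - T e) + (T e - e) := by ring
    rw [this]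
    have := norm_add_le (T x - T e) (T e - e)
    linarith
  have hcontr : ContractingWith (1 / 4) (hmaps.restrict T _ _) := by
    refine ⟨?_, LipschitzWith.of_dist_le_mul ?_⟩
    · rw [← NNReal.coe_lt_coe]; norm_num
    · intro x y
      have := hTl x (hsub x.2) y (hsub y.2)
      simpa [Subtype.dist_eq, dist_eq_norm] using this
  obtain ⟨E, hE, hfix, -⟩ := hcontr.exists_fixedPoint' (x := e)
    (Metric.isClosed_closedBall.isComplete) hmaps
    (Metric.mem_closedBall_self (by positivity)) (edist_ne_top _ _)
  have hgE : g E = 0 := by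
    have h1 : E - g E / L = E := hfix
    have h2 : g E / L = 0 := by linear_combination -h1
    simpa [hL] using h2
  refine ⟨E, hsub hE, hgE, ?_⟩
  intro E₂ hE₂ h2
  have h3 := hg E₂ hE₂ E (hsub hE)
  rw [hgE, h2, sub_zero, zero_sub, norm_neg, norm_mul] at h3
  have h4 : ‖E₂ - E‖ ≤ 0 := by
    by_contra h5
    push Not at h5
    have := mul_le_mul_of_nonneg_right hc h5.le
    nlinarith [mul_pos hLp h5]
  exact sub_eq_zero.1 (norm_le_zero_iff.1 h4)

set_option maxHeartbeats 4000000


/-- Perturbation of a real zero `ẽ` of `cos(𝒜(·)/h) + f` by an exponentially small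
holomorphic right-hand side `hF`: the equation `cos(𝒜(E)/h) + f(E) = hF(E)` has exactly
one solution `E` in `B(ẽ, C₀''h²N)` where `N = sup_Ω |F|`, and
`E = ẽ − h²F(E)/(𝒜'(ẽ) sin(𝒜(ẽ)/h)) + O(h^{5/2}N)`. -/
theorem perturbed_root_shift
    (E' d' m M C δ : ℝ)
    (hd' : 0 < d') (hm : 0 < m) (hmM : m ≤ M) (hC : 0 < C) (hδ : 0 < δ)
    (Ω : Set ℂ) (hΩ : IsOpen Ω)
    (hΩI : ∀ x : ℝ, x ∈ Set.Icc (E' - d') (E' + d') → (x : ℂ) ∈ Ω)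
    (𝒜 : ℂ → ℂ) (h𝒜 : DifferentiableOn ℂ 𝒜 Ω)
    (h𝒜real : ∀ x : ℝ, (x : ℂ) ∈ Ω → (𝒜 x).im = 0)
    (h𝒜' : ∀ x : ℝ, x ∈ Set.Icc (E' - d') (E' + d') →
      m ≤ (deriv 𝒜 x).re ∧ (deriv 𝒜 x).re ≤ M) :
    ∃ C₀'' > (0 : ℝ), ∃ h₀ > (0 : ℝ), ∀ h ∈ Set.Ioc (0 : ℝ) h₀,
      ∀ f : ℂ → ℂ, DifferentiableOn ℂ f Ω →
        (∀ z ∈ Ω, ‖f z‖ ≤ C * h ^ ((1 : ℝ) / 2)) →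
        (∀ x : ℝ, (x : ℂ) ∈ Ω → (f x).im = 0) →
      ∀ e : ℝ, e ∈ Set.Icc (E' - d' + δ) (E' + d' - δ) →
        Complex.cos (𝒜 e / (h : ℂ)) + f e = 0 →
      ∀ F : ℂ → ℂ, DifferentiableOn ℂ F Ω →
      ∀ N : ℝ, IsLUB ((fun z => ‖F z‖) '' Ω) N → 0 < N → N ≤ 1 →
      ∃ E : ℂ,
        (E ∈ Metric.ball (e : ℂ) (C₀'' * h ^ 2 * N) ∧
          Complex.cos (𝒜 E / (h : ℂ)) + f E = (h : ℂ) * F E ∧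
          ‖E - (e : ℂ) + (h : ℂ) ^ 2 * F E /
              (deriv 𝒜 e * Complex.sin (𝒜 e / (h : ℂ)))‖ ≤ C₀'' * h ^ ((5 : ℝ) / 2) * N) ∧
        ∀ E₂ ∈ Metric.ball (e : ℂ) (C₀'' * h ^ 2 * N),
          Complex.cos (𝒜 E₂ / (h : ℂ)) + f E₂ = (h : ℂ) * F E₂ → E₂ = E := by
  -- uniform radius
  set S : Set ℂ := (fun x : ℝ => (x : ℂ)) '' Set.Icc (E' - d') (E' + d') with hS
  have hScomp : IsCompact S := isCompact_Icc.image Complex.continuous_ofReal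
  have hSΩ : S ⊆ Ω := by rintro _ ⟨x, hx, rfl⟩; exact hΩI x hx
  obtain ⟨R, hR, hRΩ⟩ := hScomp.exists_cthickening_subset_open hΩ hSΩ
  obtain ⟨P₀, hP₀⟩ := (hScomp.cthickening (r := R)).exists_bound_of_continuousOn
    (h𝒜.continuousOn.mono hRΩ)
  set P : ℝ := max P₀ 1 with hP
  have hPpos : 0 < P := lt_of_lt_of_le one_pos (le_max_right _ _)
  have hAP : ∀ z ∈ Metric.cthickening R S, ‖𝒜 z‖ ≤ P := fun z hz => (hP₀ z hz).trans (le_max_left _ _)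
  set M1 : ℝ := P / (R / 2) with hM1
  set M2 : ℝ := M1 / (R / 2 / 2) with hM2
  have hM1p : 0 < M1 := by positivity
  have hM2p : 0 < M2 := by positivity
  set K : ℝ := 8 / m with hK
  have hKp : 0 < K := by positivity
  set c : ℝ := (5 * M2 * K + 4 * M1 ^ 2 * K) + C / (R / 2) + 1 / (R / 2) with hc
  have hcp : 0 < c := by positivity
  refine ⟨K, hKp, min (min (min 1 (R / 4 / K)) (min (1 / (M1 * K)) (m / (8 * c))))
    (min ((m / (2 * c)) ^ 2) (3 / (4 * C ^ 2))), by positivity, ?_⟩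
  rintro h ⟨hh, hle⟩ f hf hfC - e he hze F hF N hN hNp hN1
  simp only [le_min_iff] at hle
  obtain ⟨⟨⟨hh1, hhR⟩, hhM, hhc⟩, hhc2, hhC⟩ := hle
  rw [le_div_iff₀ (by positivity)] at hhR hhM hhc hhC
  have heI : e ∈ Set.Icc (E' - d') (E' + d') := ⟨by linarith [he.1], by linarith [he.2]⟩
  obtain ⟨q, hq, hqh⟩ : ∃ q : ℝ, 0 < q ∧ q = h ^ ((1 : ℝ) / 2) := ⟨_, Real.rpow_pos_of_pos hh _, rfl⟩
  have hq2 : q ^ 2 = h := by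
    rw [hqh, ← Real.rpow_natCast, ← Real.rpow_mul hh.le]; norm_num
  have hq5 : h ^ ((5 : ℝ) / 2) = q ^ 5 := by
    rw [hqh, ← Real.rpow_natCast, ← Real.rpow_mul hh.le]; norm_num
  have hq1 : q ≤ 1 := by nlinarith
  have hqc : q ≤ m / (2 * c) := by
    have : (0 : ℝ) ≤ m / (2 * c) := by positivity
    rw [← hq2] at hhc2
    exact (sq_le_sq₀ hq.le this).1 hhc2
  rw [le_div_iff₀ (by positivity)] at hqc
  rw [hq5]
  rw [← hqh] at hfC
  have hFN : ∀ z ∈ Ω, ‖F z‖ ≤ N := fun z hz => hN.1 (Set.mem_image_of_mem (fun z => ‖F z‖) hz)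
  have heΩ : (e : ℂ) ∈ Ω := hΩI e heI
  have hbW : Metric.ball (e : ℂ) R ⊆ Metric.cthickening R S := by
    refine Metric.ball_subset_closedBall.trans ?_
    exact Metric.closedBall_subset_cthickening (Set.mem_image_of_mem (fun x : ℝ => (x : ℂ)) heI) R
  have hbΩ : Metric.ball (e : ℂ) R ⊆ Ω := hbW.trans hRΩ
  have hb2 : Metric.ball (e : ℂ) (R / 2) ⊆ Metric.ball (e : ℂ) R := Metric.ball_subset_ball (by linarith)
  have hb4 : Metric.ball (e : ℂ) (R / 2 / 2) ⊆ Metric.ball (e : ℂ) (R / 2) :=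
    Metric.ball_subset_ball (by linarith)
  have dA1 := aux_cauchy 𝒜 e R P hR (h𝒜.mono hbΩ) (fun z hz => hAP z (hbW hz))
  have dA2 := aux_cauchy (deriv 𝒜) e (R / 2) M1 (by positivity)
    (((h𝒜.deriv hΩ).mono hbΩ).mono hb2) dA1
  have dF := aux_cauchy F e R N hR (hF.mono hbΩ) (fun z hz => hFN z (hbΩ hz))
  have df := aux_cauchy f e R (C * q) hR (hf.mono hbΩ) (fun z hz => hfC z (hbΩ hz))
  set ρ : ℝ := K * h ^ 2 * N with hρ
  have hρp : 0 < ρ := by positivity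
  have hρh : ρ ≤ K * h * h := by
    rw [hρ]
    calc K * h ^ 2 * N ≤ K * h ^ 2 * 1 := by gcongr
      _ = _ := by ring
  have hρR : ρ ≤ R / 2 / 2 := by
    have : K * h * h ≤ K * h * 1 := by gcongr
    linarith
  have hbρ : Metric.ball (e : ℂ) ρ ⊆ Metric.ball (e : ℂ) (R / 2 / 2) := Metric.ball_subset_ball hρR
  have hbρ2 := hbρ.trans hb4
  have hbρΩ := (hbρ2.trans hb2).trans hbΩ
  have hee : (e : ℂ) ∈ Metric.ball (e : ℂ) ρ := Metric.mem_ball_self hρp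
  have hcvx : Convex ℝ (Metric.ball (e : ℂ) ρ) := convex_ball _ _
  have hAat : ∀ z ∈ Ω, DifferentiableAt ℂ 𝒜 z := fun z hz => h𝒜.differentiableAt (hΩ.mem_nhds hz)
  have hfat : ∀ z ∈ Ω, DifferentiableAt ℂ f z := fun z hz => hf.differentiableAt (hΩ.mem_nhds hz)
  have hFat : ∀ z ∈ Ω, DifferentiableAt ℂ F z := fun z hz => hF.differentiableAt (hΩ.mem_nhds hz)
  have hA'at : ∀ z ∈ Ω, DifferentiableAt ℂ (deriv 𝒜) z :=
    fun z hz => (h𝒜.deriv hΩ).differentiableAt (hΩ.mem_nhds hz)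
  have lA : ∀ z ∈ Metric.ball (e : ℂ) ρ, ‖𝒜 z - 𝒜 e‖ ≤ M1 * ρ := by
    intro z hz
    refine (hcvx.norm_image_sub_le_of_norm_deriv_le (fun x hx => hAat x (hbρΩ hx))
      (fun x hx => dA1 x (hbρ2 hx)) hee hz).trans ?_
    gcongr
    exact (mem_ball_iff_norm.1 hz).le
  have lA' : ∀ z ∈ Metric.ball (e : ℂ) ρ, ‖deriv 𝒜 z - deriv 𝒜 e‖ ≤ M2 * ρ := by
    intro z hz
    refine (hcvx.norm_image_sub_le_of_norm_deriv_le (fun x hx => hA'at x (hbρΩ hx))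
      (fun x hx => dA2 x (hbρ hx)) hee hz).trans ?_
    gcongr
    exact (mem_ball_iff_norm.1 hz).le
  have hhne : (h : ℂ) ≠ 0 := by exact_mod_cast hh.ne'
  have hnh : ‖(h : ℂ)‖ = h := by rw [Complex.norm_real, Real.norm_of_nonneg hh.le]
  -- the real phase
  obtain ⟨x₀, hx₀⟩ : ∃ x₀ : ℝ, 𝒜 e / (h : ℂ) = (x₀ : ℂ) := by
    refine ⟨(𝒜 e).re / h, ?_⟩
    have : 𝒜 e = ((𝒜 e).re : ℂ) := by
      apply Complex.ext <;> simp [h𝒜real e heΩ]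
    rw [Complex.ofReal_div, ← this]
  rw [hx₀] at hze ⊢
  set a := deriv 𝒜 e with ha
  set s := Complex.sin (x₀ : ℂ) with hs
  have hs1 : ‖s‖ ≤ 1 := by
    rw [hs, ← Complex.ofReal_sin, Complex.norm_real]; exact Real.abs_sin_le_one x₀
  have hs2 : 1 / 2 ≤ ‖s‖ := by
    have h1 : ‖Complex.cos (x₀ : ℂ)‖ ≤ C * q := by
      rw [eq_neg_of_add_eq_zero_left hze, norm_neg]; exact hfC _ heΩ
    rw [hs, ← Complex.ofReal_sin, Complex.norm_real, Real.norm_eq_abs]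
    rw [← Complex.ofReal_cos, Complex.norm_real, Real.norm_eq_abs] at h1
    have h2 : Real.cos x₀ ^ 2 ≤ 3 / 4 := by
      rw [← sq_abs]
      calc _ ≤ (C * q) ^ 2 := by gcongr
        _ = C ^ 2 * h := by rw [← hq2]; ring
        _ ≤ _ := by nlinarith
    have h3 := Real.sin_sq_add_cos_sq x₀
    rw [← sq_abs] at h3
    have h4 : (1 / 2 : ℝ) ^ 2 ≤ |Real.sin x₀| ^ 2 := by linarith
    exact (sq_le_sq₀ (by norm_num) (abs_nonneg _)).1 h4
  have ham : m ≤ ‖a‖ := (h𝒜' e heI).1.trans (Complex.re_le_norm _)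
  have haM : ‖a‖ ≤ M1 := dA1 e (hbρ2 hee)
  have ha0 : a ≠ 0 := norm_pos_iff.1 (hm.trans_le ham)
  have hs0 : s ≠ 0 := norm_pos_iff.1 (by linarith)
  set L : ℂ := -(a * s) / h with hL
  have hL0 : L ≠ 0 := by
    rw [hL]; exact div_ne_zero (neg_ne_zero.2 (mul_ne_zero ha0 hs0)) hhne
  have hLn : m / (2 * h) ≤ ‖L‖ := by
    rw [hL, norm_div, norm_neg, norm_mul, hnh, div_le_div_iff₀ (by positivity) hh]
    have : m * (1 / 2) ≤ ‖a‖ * ‖s‖ := by gcongr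
    have h5 := mul_le_mul_of_nonneg_right this (by positivity : 0 ≤ 2 * h)
    linarith
  have hLp : 0 < ‖L‖ := norm_pos_iff.2 hL0
  have hmh : m ≤ ‖L‖ * (2 * h) := by rwa [div_le_iff₀ (by positivity)] at hLn
  -- main derivative estimate
  have key : ∀ z ∈ Metric.ball (e : ℂ) ρ,
      ‖-Complex.sin (𝒜 z / h) * (deriv 𝒜 z / h) - L‖ ≤ 5 * M2 * K + 4 * M1 ^ 2 * K := by
    intro z hz
    have ht : ‖𝒜 z / h - (x₀ : ℂ)‖ ≤ M1 * K * h := by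
      rw [← hx₀, ← sub_div, norm_div, hnh, div_le_iff₀ hh]
      refine (lA z hz).trans ?_
      have h5 := mul_le_mul_of_nonneg_left hρh hM1p.le
      linarith
    have ht1 : ‖𝒜 z / h - (x₀ : ℂ)‖ ≤ 1 := ht.trans (by linarith)
    have hss := aux_sin_sub x₀ _ ht1
    have hS5 : ‖Complex.sin (𝒜 z / h)‖ ≤ 5 := by
      have : Complex.sin (𝒜 z / h) = (Complex.sin (𝒜 z / h) - s) + s := by ring
      rw [this]
      have := norm_add_le (Complex.sin (𝒜 z / h) - s) s
      linarith
    have e1 : -Complex.sin (𝒜 z / h) * (deriv 𝒜 z / h) - L =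
        -((deriv 𝒜 z - a) * Complex.sin (𝒜 z / h) + a * (Complex.sin (𝒜 z / h) - s)) / h := by
      rw [hL]; ring
    rw [e1, norm_div, norm_neg, hnh, div_le_iff₀ hh]
    refine (norm_add_le _ _).trans ?_
    rw [norm_mul, norm_mul]
    calc _ ≤ (M2 * (K * h * 1)) * 5 + M1 * (4 * (M1 * K * h)) := by
          have h1 : ‖deriv 𝒜 z - a‖ ≤ M2 * (K * h * 1) := by
            refine (lA' z hz).trans ?_
            gcongr
            refine hρh.trans ?_
            gcongr
          have h2 : ‖Complex.sin (𝒜 z / h) - s‖ ≤ 4 * (M1 * K * h) := hss.trans (by linarith)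
          gcongr
      _ = _ := by ring
  set g₀ : ℂ → ℂ := fun z => Complex.cos (𝒜 z / h) + f z with hg₀
  have hd₀ : ∀ z ∈ Ω, HasDerivAt g₀ (-Complex.sin (𝒜 z / h) * (deriv 𝒜 z / h) + deriv f z) z := by
    intro z hz
    exact (((hAat z hz).hasDerivAt.div_const (h : ℂ)).ccos).add (hfat z hz).hasDerivAt
  have df' : ∀ z ∈ Metric.ball (e : ℂ) ρ, ‖deriv f z‖ ≤ C / (R / 2) := by
    intro z hz
    refine (df z (hbρ2 hz)).trans ?_
    gcongr
    exact mul_le_of_le_one_right hC.le hq1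
  have dF' : ∀ z ∈ Metric.ball (e : ℂ) ρ, ‖(h : ℂ) * deriv F z‖ ≤ 1 / (R / 2) := by
    intro z hz
    rw [norm_mul, hnh]
    calc _ ≤ 1 * (N / (R / 2)) := by
          gcongr
          exact dF z (hbρ2 hz)
      _ ≤ _ := by rw [one_mul]; gcongr
  have lip₀ : ∀ x ∈ Metric.ball (e : ℂ) ρ, ∀ y ∈ Metric.ball (e : ℂ) ρ,
      ‖g₀ x - g₀ y - L * (x - y)‖ ≤ c * ‖x - y‖ := by
    intro x hx y hy
    have := hcvx.norm_image_sub_le_of_norm_hasDerivWithin_le (f := fun z => g₀ z - L * z)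
      (f' := fun z => -Complex.sin (𝒜 z / h) * (deriv 𝒜 z / h) + deriv f z - L) (C := c)
      (fun z hz => ((hd₀ z (hbρΩ hz)).sub
        (by simpa using (hasDerivAt_id z).const_mul L)).hasDerivWithinAt) ?_ hy hx
    · refine le_trans (le_of_eq (congrArg norm ?_)) this
      ring
    · intro z hz
      have e1 : -Complex.sin (𝒜 z / h) * (deriv 𝒜 z / h) + deriv f z - L =
        (-Complex.sin (𝒜 z / h) * (deriv 𝒜 z / h) - L) + deriv f z := by ring
      simp only [e1]
      refine (norm_add_le _ _).trans ?_
      have h3 : 0 < 1 / (R / 2) := by positivity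
      linarith [key z hz, df' z hz]
  have lip : ∀ x ∈ Metric.ball (e : ℂ) ρ, ∀ y ∈ Metric.ball (e : ℂ) ρ,
      ‖(g₀ x - h * F x) - (g₀ y - h * F y) - L * (x - y)‖ ≤ c * ‖x - y‖ := by
    intro x hx y hy
    have := hcvx.norm_image_sub_le_of_norm_hasDerivWithin_le (f := fun z => (g₀ z - h * F z) - L * z)
      (f' := fun z => -Complex.sin (𝒜 z / h) * (deriv 𝒜 z / h) + deriv f z - h * deriv F z - L) (C := c)
      (fun z hz => (((hd₀ z (hbρΩ hz)).sub ((hFat z (hbρΩ hz)).hasDerivAt.const_mul (h : ℂ))).sub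
        (by simpa using (hasDerivAt_id z).const_mul L)).hasDerivWithinAt) ?_ hy hx
    · refine le_trans (le_of_eq (congrArg norm ?_)) this
      ring
    · intro z hz
      have e1 : -Complex.sin (𝒜 z / h) * (deriv 𝒜 z / h) + deriv f z - h * deriv F z - L =
        (-Complex.sin (𝒜 z / h) * (deriv 𝒜 z / h) - L) + deriv f z - h * deriv F z := by ring
      simp only [e1]
      refine (norm_sub_le _ _).trans ?_
      have := norm_add_le (-Complex.sin (𝒜 z / h) * (deriv 𝒜 z / h) - L) (deriv f z)
      linarith [key z hz, df' z hz, dF' z hz]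
  have hg₀e : g₀ e = 0 := by simp only [hg₀]; rw [hx₀]; exact hze
  have hKm : K * m = 8 := by rw [hK]; field_simp
  obtain ⟨E, hE, hgE, huniq⟩ := aux_root (fun z => g₀ z - h * F z) e L ρ c hρp hL0
    (by
      have h1 : c ≤ m / (2 * h) / 4 := by
        rw [div_div, le_div_iff₀ (by positivity)]; linarith
      linarith)
    (by
      simp only [hg₀e, zero_sub, norm_neg, norm_mul, hnh]
      have h1 : h * ‖F e‖ ≤ h * N := by gcongr; exact hFN _ heΩ
      have h2 : m / (2 * h) * ρ / 4 = h * N := by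
        rw [hρ]; field_simp; linear_combination hKm
      have h3 : m / (2 * h) * ρ / 4 ≤ ‖L‖ * ρ / 4 := by gcongr
      linarith) lip
  refine ⟨E, ⟨hE, sub_eq_zero.1 hgE, ?_⟩, fun E₂ hE₂ h2 => huniq E₂ hE₂ (sub_eq_zero.2 h2)⟩
  have h1 := lip₀ E hE e hee
  rw [hg₀e, sub_zero, show g₀ E = h * F E from sub_eq_zero.1 hgE] at h1
  have e2 : E - (e : ℂ) + (h : ℂ) ^ 2 * F E / (a * s) = -((h * F E - L * (E - e)) / L) := by
    rw [hL]; field_simp; ring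
  rw [e2, norm_neg, norm_div, div_le_iff₀ hLp]
  refine h1.trans ?_
  have h2 : ‖E - e‖ ≤ ρ := (mem_ball_iff_norm.1 hE).le
  calc c * ‖E - e‖ ≤ c * ρ := by gcongr
    _ = K * q ^ 4 * N * c := by rw [hρ, ← hq2]; ring
    _ ≤ K * q ^ 4 * N * (q * (m / (2 * h))) := by
        gcongr
        rw [← mul_div_assoc, le_div_iff₀ (by positivity), ← hq2]
        have h5 := mul_le_mul_of_nonneg_left hqc hq.le
        linarith
    _ ≤ K * q ^ 4 * N * (q * ‖L‖) := by gcongr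
    _ = _ := by ring
end

section
/- Let J ⊂ ℝ be an open interval and let V be real analytic on a neighborhood of a compact interval [α, β] ⊂ ℝ such that for each E ∈ J the equation V(t) = E has exactly two solutions a(E) < b(E) in [α, β], with V < E on (a(E), b(E)), V'(a(E)) < 0 and V'(b(E)) > 0. Then the function 𝒜(E) := ∫_{a(E)}^{b(E)} √(E − V(t)) dt is differentiable (indeed real analytic) on J, the improper integral ∫_{a(E)}^{b(E)} dt/(2√(E − V(t))) converges, and 𝒜'(E) = ∫_{a(E)}^{b(E)} dt/(2√(E − V(t))) > 0 for all E ∈ J. -/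
open MeasureTheory Set Filter Topology
open scoped NNReal ENNReal

theorem param_local {P : Type*} [NormedAddCommGroup P] [NormedSpace ℝ P]
    (F : P × ℝ → ℝ) (w : ℝ → ℝ) (hw : Continuous w) (p₀ : P) (u₀ : ℝ)
    (hF : AnalyticAt ℝ F (p₀, u₀)) :
    ∃ R > 0, ∀ t : Set ℝ, MeasurableSet t → t ⊆ Metric.closedBall u₀ R →
      AnalyticAt ℝ (fun y => ∫ u in t, w u * F (y, u)) p₀ ∧
      ∀ᶠ y in 𝓝 p₀, IntegrableOn (fun u => w u * F (y, u)) t := by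
  obtain ⟨p, r, hp⟩ := hF
  obtain ⟨R', hR'0, hR'⟩ : ∃ R' : ℝ≥0, 0 < R' ∧ (R' : ℝ≥0∞) < r := by
    obtain ⟨x, hx⟩ := ENNReal.lt_iff_exists_nnreal_btwn.1 hp.r_pos
    exact ⟨x, by exact_mod_cast hx.1, hx.2⟩
  set R : ℝ≥0 := R' / 2 with hRdef
  have hR0 : 0 < R := by positivity
  have hRR : (R : ℝ≥0∞) + R < r := by
    rw [← ENNReal.coe_add, hRdef, add_halves]; exact hR'
  have hRr : (R : ℝ≥0∞) < r := lt_of_le_of_lt le_self_add hRR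
  have hRad : (R : ℝ≥0∞) + R < p.radius := hRR.trans_le hp.r_le
  refine ⟨R, by exact_mod_cast hR0, fun t ht htR => ?_⟩
  have hK : IsCompact (Metric.closedBall u₀ (R:ℝ)) := isCompact_closedBall _ _
  have htfin : volume t ≠ ⊤ := ((measure_mono htR).trans_lt hK.measure_lt_top).ne
  obtain ⟨M, hM⟩ := hK.exists_bound_of_continuousOn hw.continuousOn
  have hM0 : 0 ≤ M := (norm_nonneg _).trans (hM u₀ (by simp))
  let v : ℝ → P × ℝ := fun u => (0, u - u₀)
  have hv : ∀ u ∈ Metric.closedBall u₀ (R:ℝ), ‖v u‖₊ ≤ R := by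
    intro u hu
    rw [← NNReal.coe_le_coe, coe_nnnorm]
    simpa [v, Prod.norm_def, Real.dist_eq] using hu
  let q : ℝ → ∀ n, ContinuousMultilinearMap ℝ (fun _ : Fin n => P) ℝ := fun u n =>
    (p.changeOrigin (v u) n).compContinuousLinearMap (fun _ => ContinuousLinearMap.inl ℝ P ℝ)
  -- continuity
  have hqc : ∀ n, ContinuousOn (fun u => q u n) (Metric.closedBall u₀ (R:ℝ)) := by
    intro n
    have h1 := (p.hasFPowerSeriesOnBall_changeOrigin n (hp.r_pos.trans_le hp.r_le)).continuousOn
    have h2 : ContinuousOn (fun u => p.changeOrigin (v u) n) (Metric.closedBall u₀ (R:ℝ)) := by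
      refine h1.comp (by fun_prop) ?_
      intro u hu
      rw [mem_eball_zero_iff]
      refine lt_of_le_of_lt ?_ (hRr.trans_le hp.r_le)
      exact_mod_cast hv u hu
    exact (ContinuousMultilinearMap.compContinuousLinearMapL (fun _ : Fin n => ContinuousLinearMap.inl ℝ P ℝ)).continuous.comp_continuousOn h2
  -- bound
  let B : ℕ → ℝ≥0 := fun k => ∑' s : Σ l : ℕ, { s : Finset (Fin (k + l)) // s.card = l },
    ‖p (k + s.1)‖₊ * R ^ s.1
  have hBsum : Summable fun k => B k * R ^ k := by
    simpa only [B, ← NNReal.tsum_mul_right] using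
      (NNReal.summable_sigma.1 (p.changeOriginSeries_summable_aux₁ hRad)).2
  have hqB : ∀ n, ∀ u ∈ Metric.closedBall u₀ (R:ℝ), ‖q u n‖ ≤ B n := by
    intro n u hu
    have h1 : ‖p.changeOrigin (v u) n‖₊ ≤ B n := by
      refine (p.nnnorm_changeOrigin_le n ?_).trans ?_
      · refine lt_of_le_of_lt ?_ (hRr.trans_le hp.r_le)
        exact_mod_cast hv u hu
      · refine Summable.tsum_le_tsum (fun s => ?_) ?_ ?_
        · gcongr; exact hv u hu
        · refine p.changeOriginSeries_summable_aux₂ ?_ n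
          refine lt_of_le_of_lt ?_ (hRr.trans_le hp.r_le)
          exact_mod_cast hv u hu
        · exact p.changeOriginSeries_summable_aux₂ (hRr.trans_le hp.r_le) n
    refine (ContinuousMultilinearMap.norm_compContinuousLinearMap_le _ _).trans ?_
    have h2 : ∏ _i : Fin n, ‖ContinuousLinearMap.inl ℝ P ℝ‖ ≤ 1 :=
      Finset.prod_le_one (fun _ _ => norm_nonneg _)
        (fun _ _ => ContinuousLinearMap.norm_inl_le_one ℝ P ℝ)
    calc _ ≤ ‖p.changeOrigin (v u) n‖ * 1 := by gcongr
      _ ≤ B n := by rw [mul_one]; exact_mod_cast h1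
  -- sum
  have hqs : ∀ u ∈ Metric.closedBall u₀ (R:ℝ), ∀ y : P, ‖y‖₊ < R →
      HasSum (fun n => q u n (fun _ => y)) (F (p₀ + y, u)) := by
    intro u hu y hy
    have h1 : (‖v u‖₊ : ℝ≥0∞) < r := lt_of_le_of_lt (by exact_mod_cast hv u hu) hRr
    have h2 := (hp.changeOrigin h1).hasSum (y := (y, 0)) (by
      rw [mem_eball_zero_iff, lt_tsub_iff_right]
      refine lt_of_le_of_lt ?_ hRR
      gcongr
      · have : ‖((y, 0) : P × ℝ)‖₊ ≤ R := by simpa [Prod.nnnorm_def] using hy.le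
        exact_mod_cast this
      · exact hv u hu)
    simpa [q, v, Function.comp_def] using h2
  have hint : ∀ n, IntegrableOn (fun u => w u • q u n) t := fun n =>
    ((hw.continuousOn.smul (hqc n)).integrableOn_compact hK).mono_set htR
  let Q : FormalMultilinearSeries ℝ P ℝ := fun n => ∫ u in t, w u • q u n
  have hQB : ∀ n, ‖Q n‖ ≤ M * B n * (volume t).toReal := by
    intro n
    refine norm_setIntegral_le_of_norm_le_const htfin.lt_top fun u hu => ?_
    rw [norm_smul]
    gcongr
    exacts [hM u (htR hu), hqB n u (htR hu)]
  have hBs' : Summable fun k => (B k : ℝ) * (R:ℝ) ^ k := by exact_mod_cast hBsum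
  have hsumm : ∀ y : P, ‖y‖₊ < R → ∀ u ∈ t, ∀ n, ‖w u * q u n (fun _ => y)‖ ≤ M * (B n * R ^ n) := by
    intro y hy u hu n
    rw [norm_mul]
    gcongr
    · exact hM u (htR hu)
    · refine ((q u n).le_opNorm _).trans ?_
      simp only [Finset.prod_const, Finset.card_univ, Fintype.card_fin]
      gcongr
      exacts [hqB n u (htR hu), by exact_mod_cast hy.le]
  have hQap : ∀ n (y : P), Q n (fun _ => y) = ∫ u in t, w u * q u n (fun _ => y) := by
    intro n y
    have := (ContinuousMultilinearMap.apply ℝ (fun _ : Fin n => P) ℝ (fun _ => y)).integral_comp_comm (hint n)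
    simpa using this.symm
  have hiap : ∀ n (y : P), IntegrableOn (fun u => w u * q u n (fun _ => y)) t := by
    intro n y
    exact (ContinuousMultilinearMap.apply ℝ (fun _ : Fin n => P) ℝ (fun _ => y)).integrable_comp (hint n)
  constructor
  · refine ⟨Q, R, ?_, by exact_mod_cast hR0, ?_⟩
    · refine Q.le_radius_of_summable ?_
      refine Summable.of_nonneg_of_le (fun n => by positivity) (fun n => ?_)
        (hBs'.mul_left (M * (volume t).toReal))
      calc _ ≤ (M * B n * (volume t).toReal) * (R:ℝ) ^ n := by gcongr; exact hQB n
        _ = _ := by ring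
    · intro y hy
      rw [mem_eball_zero_iff] at hy
      have hy' : ‖y‖₊ < R := by exact_mod_cast hy
      simp only [hQap]
      refine hasSum_integral_of_dominated_convergence (fun n _ => M * (B n * R ^ n))
        (fun n => (hiap n y).aestronglyMeasurable) (fun n => ?_) ?_ ?_ ?_
      · exact (ae_restrict_iff' ht).2 (ae_of_all _ fun u hu => hsumm y hy' u hu n)
      · exact ae_of_all _ fun u => hBs'.mul_left M
      · exact integrableOn_const htfin
      · exact (ae_restrict_iff' ht).2 (ae_of_all _ fun u hu => (hqs u (htR hu) y hy').mul_left _)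
  · have : ∀ᶠ y in 𝓝 p₀, y ∈ Metric.ball p₀ (R:ℝ) := Metric.ball_mem_nhds _ (by exact_mod_cast hR0)
    filter_upwards [this] with y hy
    have hy' : ‖y - p₀‖₊ < R := by
      rw [Metric.mem_ball, dist_eq_norm] at hy; exact_mod_cast hy
    have hs : ∀ u ∈ t, HasSum (fun n => w u * q u n (fun _ => y - p₀)) (w u * F (y, u)) := by
      intro u hu
      have := (hqs u (htR hu) _ hy').mul_left (w u)
      simpa using this
    have h1 : IntegrableOn (fun u => ∑' n, w u * q u n (fun _ => y - p₀)) t := by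
      refine Integrable.mono' (g := fun _ => ∑' n, M * ((B n : ℝ) * (R:ℝ) ^ n)) (integrableOn_const htfin) ?_ ?_
      · refine aestronglyMeasurable_of_tendsto_ae (f := fun (m:ℕ) u => ∑ n ∈ Finset.range m, w u * q u n (fun _ => y - p₀)) atTop (fun m => ?_) ?_
        · exact Finset.aestronglyMeasurable_fun_sum _ fun n _ => (hiap n _).aestronglyMeasurable
        · exact (ae_restrict_iff' ht).2 (ae_of_all _ fun u hu => by
            rw [(hs u hu).tsum_eq]; exact (hs u hu).tendsto_sum_nat)
      · exact (ae_restrict_iff' ht).2 (ae_of_all _ fun u hu =>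
          tsum_of_norm_bounded (hBs'.mul_left M).hasSum (hsumm _ hy' u hu))
    exact h1.congr_fun (fun u hu => (hs u hu).tsum_eq) ht

theorem param_analytic {P : Type*} [NormedAddCommGroup P] [NormedSpace ℝ P]
    (F : P × ℝ → ℝ) (w : ℝ → ℝ) (hw : Continuous w) (p₀ : P)
    (hF : ∀ u ∈ Icc (0:ℝ) 1, AnalyticAt ℝ F (p₀, u)) :
    AnalyticAt ℝ (fun y => ∫ u in (0:ℝ)..1, w u * F (y, u)) p₀ := by
  have key : ∃ s', MeasurableSet s' ∧ Icc (0:ℝ) 1 ⊆ s' ∧ ∀ t : Set ℝ, MeasurableSet t → t ⊆ s' →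
      AnalyticAt ℝ (fun y => ∫ u in t, w u * F (y, u)) p₀ ∧
      ∀ᶠ y in 𝓝 p₀, IntegrableOn (fun u => w u * F (y, u)) t := by
    refine isCompact_Icc.induction_on (p := fun s => ∃ s', MeasurableSet s' ∧ s ⊆ s' ∧
      ∀ t : Set ℝ, MeasurableSet t → t ⊆ s' →
      AnalyticAt ℝ (fun y => ∫ u in t, w u * F (y, u)) p₀ ∧
      ∀ᶠ y in 𝓝 p₀, IntegrableOn (fun u => w u * F (y, u)) t) ?_ ?_ ?_ ?_
    · refine ⟨∅, .empty, subset_rfl, fun t _ ht => ?_⟩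
      obtain rfl := subset_empty_iff.1 ht
      simpa using analyticAt_const
    · rintro s t hst ⟨s', h1, h2, h3⟩
      exact ⟨s', h1, hst.trans h2, h3⟩
    · rintro s t ⟨s', h1, h2, h3⟩ ⟨t', k1, k2, k3⟩
      refine ⟨s' ∪ t', h1.union k1, union_subset_union h2 k2, fun x hx hxs => ?_⟩
      obtain ⟨a1, a2⟩ := h3 (x ∩ s') (hx.inter h1) inter_subset_right
      obtain ⟨b1, b2⟩ := k3 (x \ s') (hx.diff h1) (by
        rintro z ⟨hz, hz'⟩; exact (hxs hz).resolve_left hz')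
      constructor
      · refine (a1.add b1).congr ?_
        filter_upwards [a2, b2] with y hy1 hy2
        simp only [Pi.add_apply]
        rw [← setIntegral_union _ (hx.diff h1) hy1 hy2, inter_union_sdiff]
        exact disjoint_sdiff_inter.symm
      · filter_upwards [a2, b2] with y hy1 hy2
        have := hy1.union hy2
        rwa [inter_union_sdiff] at this
    · intro u hu
      obtain ⟨R, hR, h⟩ := param_local F w hw p₀ u (hF u hu)
      exact ⟨Metric.closedBall u R, mem_nhdsWithin_of_mem_nhds (Metric.closedBall_mem_nhds _ hR),
        _, Metric.isClosed_closedBall.measurableSet, subset_rfl, h⟩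
  obtain ⟨s', h1, h2, h3⟩ := key
  simp only [intervalIntegral.integral_of_le zero_le_one]
  exact (h3 _ measurableSet_Ioc (Ioc_subset_Icc_self.trans h2)).1

theorem hadamard_div {P : Type*} [NormedAddCommGroup P] [NormedSpace ℝ P]
    (f : P × ℝ → ℝ) (S : Set P) (α β : ℝ)
    (hf : ∀ p ∈ S, ∀ y ∈ Icc α β, AnalyticAt ℝ f (p, y)) :
    ∃ h : P × ℝ × ℝ → ℝ, ∀ p ∈ S, ∀ z ∈ Icc α β, ∀ y ∈ Icc α β,
      AnalyticAt ℝ h (p, z, y) ∧ f (p, y) - f (p, z) = (y - z) * h (p, z, y) := by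
  let D : P × ℝ → ℝ := fun x => fderiv ℝ f x (0, 1)
  have hseg : ∀ z ∈ Icc α β, ∀ y ∈ Icc α β, ∀ s ∈ Icc (0:ℝ) 1, z + s * (y - z) ∈ Icc α β := by
    intro z hz y hy s hs
    have := (convex_Icc α β).add_smul_sub_mem hz hy hs
    simpa using this
  have hD : ∀ p ∈ S, ∀ y ∈ Icc α β, AnalyticAt ℝ D (p, y) := by
    intro p hp y hy
    exact ((ContinuousLinearMap.apply ℝ ℝ ((0 : P), (1:ℝ))).analyticAt _).comp (hf p hp y hy).fderiv
  refine ⟨fun x => ∫ s in (0:ℝ)..1, 1 * D (x.1, x.2.1 + s * (x.2.2 - x.2.1)), ?_⟩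
  intro p hp z hz y hy
  constructor
  · refine param_analytic (P := P × ℝ × ℝ)
      (fun x => D (x.1.1, x.1.2.1 + x.2 * (x.1.2.2 - x.1.2.1))) (fun _ => 1)
      continuous_const (p, z, y) fun u hu => ?_
    have h1 := hD p hp _ (hseg z hz y hy u hu)
    have e1 : AnalyticAt ℝ (fun x : (P × ℝ × ℝ) × ℝ => x.1.1) ((p, z, y), u) :=
      ((ContinuousLinearMap.fst ℝ P (ℝ × ℝ)).comp (ContinuousLinearMap.fst ℝ _ ℝ)).analyticAt _
    have e2 : AnalyticAt ℝ (fun x : (P × ℝ × ℝ) × ℝ => x.1.2.1) ((p, z, y), u) :=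
      ((ContinuousLinearMap.fst ℝ ℝ ℝ).comp ((ContinuousLinearMap.snd ℝ P (ℝ × ℝ)).comp
        (ContinuousLinearMap.fst ℝ _ ℝ))).analyticAt _
    have e3 : AnalyticAt ℝ (fun x : (P × ℝ × ℝ) × ℝ => x.1.2.2) ((p, z, y), u) :=
      ((ContinuousLinearMap.snd ℝ ℝ ℝ).comp ((ContinuousLinearMap.snd ℝ P (ℝ × ℝ)).comp
        (ContinuousLinearMap.fst ℝ _ ℝ))).analyticAt _
    have e4 : AnalyticAt ℝ (fun x : (P × ℝ × ℝ) × ℝ => x.2) ((p, z, y), u) := analyticAt_snd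
    exact AnalyticAt.fun_comp (f := fun x : (P × ℝ × ℝ) × ℝ =>
      (x.1.1, x.1.2.1 + x.2 * (x.1.2.2 - x.1.2.1))) (x := ((p, z, y), u)) h1
      (e1.prod (e2.add (e4.mul (e3.sub e2))))
  · have hder : ∀ s ∈ uIcc (0:ℝ) 1, HasDerivAt (fun s => f (p, z + s * (y - z)))
        ((y - z) * D (p, z + s * (y - z))) s := by
      intro s hs
      rw [uIcc_of_le zero_le_one] at hs
      have h1 := (hf p hp _ (hseg z hz y hy s hs)).differentiableAt.hasFDerivAt
      have h2 : HasDerivAt (fun s : ℝ => (p, z + s * (y - z))) ((0 : P), y - z) s := by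
        refine (hasDerivAt_const s p).prodMk ?_
        simpa using ((hasDerivAt_id s).mul_const (y - z)).const_add z
      have h3 := h1.comp_hasDerivAt s h2
      have h4 : ((0 : P), y - z) = (y - z) • ((0 : P), (1:ℝ)) := by simp
      rw [h4, map_smul] at h3
      exact h3
    have hcont : ContinuousOn (fun s => (y - z) * D (p, z + s * (y - z))) (uIcc (0:ℝ) 1) := by
      intro s hs
      rw [uIcc_of_le zero_le_one] at hs
      have h1 := (hD p hp _ (hseg z hz y hy s hs)).continuousAt
      have h2 : ContinuousAt (fun s => D (p, z + s * (y - z))) s :=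
        ContinuousAt.comp' (f := fun s : ℝ => (p, z + s * (y - z))) h1 (by fun_prop)
      exact (continuousAt_const.mul h2).continuousWithinAt
    have := intervalIntegral.integral_eq_sub_of_hasDerivAt hder hcont.intervalIntegrable
    simp only [one_mul]
    rw [← intervalIntegral.integral_const_mul, this]
    simp

theorem sqrt_analyticAt {x : ℝ} (hx : 0 < x) : AnalyticAt ℝ Real.sqrt x := by
  have h : AnalyticAt ℝ (fun y => Real.exp (Real.log y * (1/2))) x :=
    ((analyticAt_id.log hx).mul analyticAt_const).rexp
  refine h.congr ?_
  filter_upwards [lt_mem_nhds hx] with y hy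
  rw [Real.sqrt_eq_rpow, Real.rpow_def_of_pos hy]

theorem left_gt {V : ℝ → ℝ} {x : ℝ} (hd : deriv V x < 0) {t : ℝ} (ht : t < x) :
    ∃ s ∈ Ioo t x, V x < V s := by
  have h := (differentiableAt_of_deriv_ne_zero hd.ne).hasDerivAt
  rw [hasDerivAt_iff_tendsto_slope] at h
  have h1 := (h.mono_left (nhdsLT_le_nhdsNE x)).eventually (gt_mem_nhds hd)
  obtain ⟨s, hs, hs'⟩ := (h1.and (Ioo_mem_nhdsLT ht)).exists
  refine ⟨s, hs', ?_⟩
  rw [slope_def_field, div_neg_iff] at hs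
  rcases hs with hs | hs <;> linarith [hs'.2]

theorem right_gt {V : ℝ → ℝ} {x : ℝ} (hd : 0 < deriv V x) {t : ℝ} (ht : x < t) :
    ∃ s ∈ Ioo x t, V x < V s := by
  have h := (differentiableAt_of_deriv_ne_zero hd.ne').hasDerivAt
  rw [hasDerivAt_iff_tendsto_slope] at h
  have h1 := (h.mono_left (nhdsGT_le_nhdsNE x)).eventually (lt_mem_nhds hd)
  obtain ⟨s, hs, hs'⟩ := (h1.and (Ioo_mem_nhdsGT ht)).exists
  refine ⟨s, hs', ?_⟩
  rw [slope_def_field, div_pos_iff] at hs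
  rcases hs with hs | hs <;> linarith [hs'.1]

theorem well_left {V : ℝ → ℝ} {α β x z E : ℝ} (hVc : ContinuousOn V (Icc α β))
    (hx : x ∈ Icc α β) (hxz : x < z) (hVx : V x = E)
    (hu : ∀ t ∈ Icc α β, V t = E → t = x ∨ t = z) (hd : deriv V x < 0) :
    ∀ t ∈ Icc α β, t < x → E < V t := by
  intro t ht htx
  by_contra! hc
  obtain ⟨s, hs, hs'⟩ := left_gt hd htx
  have hsub : Icc t s ⊆ Icc α β := Icc_subset_Icc ht.1 (hs.2.le.trans hx.2)
  obtain ⟨y, hy, hy'⟩ := intermediate_value_Icc hs.1.le (hVc.mono hsub) ⟨hc, by rw [← hVx]; exact hs'.le⟩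
  rcases hu y (hsub hy) hy' with h | h <;> linarith [hy.2, hs.2]

theorem well_right {V : ℝ → ℝ} {α β x z E : ℝ} (hVc : ContinuousOn V (Icc α β))
    (hz : z ∈ Icc α β) (hxz : x < z) (hVz : V z = E)
    (hu : ∀ t ∈ Icc α β, V t = E → t = x ∨ t = z) (hd : 0 < deriv V z) :
    ∀ t ∈ Icc α β, z < t → E < V t := by
  intro t ht htx
  by_contra! hc
  obtain ⟨s, hs, hs'⟩ := right_gt hd htx
  have hsub : Icc s t ⊆ Icc α β := Icc_subset_Icc (hz.1.trans hs.1.le) ht.2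
  obtain ⟨y, hy, hy'⟩ := intermediate_value_Icc' hs.2.le (hVc.mono hsub) ⟨hc, by rw [← hVz]; exact hs'.le⟩
  rcases hu y (hsub hy) hy' with h | h <;> linarith [hy.1, hs.1]

theorem local_inv {V : ℝ → ℝ} {x : ℝ} (hV : AnalyticAt ℝ V x) (hd : deriv V x ≠ 0) :
    ∃ g : ℝ → ℝ, AnalyticAt ℝ g (V x) ∧ g (V x) = x ∧ ∀ᶠ E in 𝓝 (V x), V (g E) = E := by
  refine ⟨_, hV.analyticAt_localInverse hd, ?_, ?_⟩
  · exact HasStrictFDerivAt.localInverse_apply_image (hV.hasStrictDerivAt.hasStrictFDerivAt_equiv hd)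
  · exact HasStrictFDerivAt.eventually_right_inverse (hV.hasStrictDerivAt.hasStrictFDerivAt_equiv hd)

theorem inv_sqrt_integrable {x z : ℝ} (hxz : x < z) :
    IntervalIntegrable (fun t => (t - x) ^ (-(1/2) : ℝ) + (z - t) ^ (-(1/2) : ℝ)) volume x z := by
  have h := @intervalIntegral.intervalIntegrable_rpow' 0 (z - x) (-(1/2)) (by norm_num)
  have h1 := h.comp_sub_right x
  have h2 := h.comp_sub_left z
  simp only [zero_add, sub_zero, sub_add_cancel, sub_sub_cancel] at h1 h2
  exact h1.add h2.symm

theorem inv_sqrt_bound {x y : ℝ} (hx : 0 < x) (hy : 0 < y) :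
    1 / Real.sqrt (x * y) ≤ (x ^ (-(1/2) : ℝ) + y ^ (-(1/2) : ℝ)) / Real.sqrt (x + y) := by
  rw [Real.rpow_neg hx.le, Real.rpow_neg hy.le, ← Real.sqrt_eq_rpow, ← Real.sqrt_eq_rpow,
    Real.sqrt_mul hx.le]
  have h1 := Real.sqrt_pos.2 hx
  have h2 := Real.sqrt_pos.2 hy
  have h3 := Real.sqrt_pos.2 (add_pos hx hy)
  have h4 : Real.sqrt (x + y) ≤ Real.sqrt x + Real.sqrt y := by
    rw [Real.sqrt_le_left (by positivity)]
    nlinarith [Real.sq_sqrt hx.le, Real.sq_sqrt hy.le]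
  rw [le_div_iff₀ h3]
  have : (Real.sqrt x)⁻¹ + (Real.sqrt y)⁻¹ = (Real.sqrt x + Real.sqrt y) / (Real.sqrt x * Real.sqrt y) := by
    field_simp; ring
  rw [this, div_mul_eq_mul_div, one_mul]
  gcongr

theorem sqrt_slope_bound {x y : ℝ} (hx : 0 < x) (hy : y < x) :
    |(Real.sqrt y - Real.sqrt x) / (y - x)| ≤ 1 / Real.sqrt x := by
  have h1 := Real.sqrt_pos.2 hx
  have h2 := Real.sqrt_le_sqrt hy.le
  have h3 := Real.sqrt_nonneg y
  rw [abs_div, abs_of_nonpos (by linarith : Real.sqrt y - Real.sqrt x ≤ 0), abs_of_neg (by linarith : y - x < 0),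
    div_le_div_iff₀ (by linarith) h1]
  have h4 := Real.mul_self_sqrt hx.le
  rcases le_total 0 y with h | h
  · have h5 := Real.mul_self_sqrt h
    nlinarith
  · rw [Real.sqrt_eq_zero_of_nonpos h]
    linarith

/-- Differentiability (indeed real analyticity) of the action integral
`𝒜(E) = ∫_{a(E)}^{b(E)} √(E − V(t)) dt` over a potential well with simple turning points,
convergence of the improper integral `∫ dt/(2√(E − V))`, and the formula
`𝒜'(E) = ∫_{a(E)}^{b(E)} dt/(2√(E − V(t))) > 0`. -/
theorem action_integral_derivative
    (J : Set ℝ) (hJopen : IsOpen J) (hJconn : J.OrdConnected)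
    (α β : ℝ) (hαβ : α < β)
    (U : Set ℝ) (hU : IsOpen U) (hUsub : Set.Icc α β ⊆ U)
    (V : ℝ → ℝ) (hV : AnalyticOnNhd ℝ V U)
    (a b : ℝ → ℝ)
    (hturn : ∀ E ∈ J, a E ∈ Set.Icc α β ∧ b E ∈ Set.Icc α β ∧ a E < b E ∧
      V (a E) = E ∧ V (b E) = E ∧
      (∀ t ∈ Set.Icc α β, V t = E → t = a E ∨ t = b E) ∧
      (∀ t ∈ Set.Ioo (a E) (b E), V t < E) ∧
      deriv V (a E) < 0 ∧ 0 < deriv V (b E))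
    (𝒜 : ℝ → ℝ) (h𝒜 : ∀ E, 𝒜 E = ∫ t in (a E)..(b E), Real.sqrt (E - V t)) :
    ∀ E ∈ J, AnalyticAt ℝ 𝒜 E ∧
      IntervalIntegrable (fun t => 1 / (2 * Real.sqrt (E - V t)))
        MeasureTheory.volume (a E) (b E) ∧
      HasDerivAt 𝒜 (∫ t in (a E)..(b E), 1 / (2 * Real.sqrt (E - V t))) E ∧
      0 < ∫ t in (a E)..(b E), 1 / (2 * Real.sqrt (E - V t)) := by
  have hVan : ∀ t ∈ Icc α β, AnalyticAt ℝ V t := fun t ht => hV t (hUsub ht)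
  have hVc : ContinuousOn V (Icc α β) := fun t ht => (hVan t ht).continuousAt.continuousWithinAt
  have hL : ∀ E ∈ J, ∀ t ∈ Icc α β, t < a E → E < V t := by
    intro E hE
    obtain ⟨h1, h2, h3, h4, h5, h6, h7, h8, h9⟩ := hturn E hE
    exact well_left hVc h1 h3 h4 h6 h8
  have hR : ∀ E ∈ J, ∀ t ∈ Icc α β, b E < t → E < V t := by
    intro E hE
    obtain ⟨h1, h2, h3, h4, h5, h6, h7, h8, h9⟩ := hturn E hE
    exact well_right hVc h2 h3 h5 h6 h9
  have hmono : ∀ E ∈ J, ∀ E' ∈ J, E < E' → a E' < a E ∧ b E < b E' := by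
    intro E hE E' hE' hlt
    obtain ⟨h1, h2, h3, h4, h5, h6, h7, h8, h9⟩ := hturn E hE
    obtain ⟨k1, k2, k3, k4, k5, k6, k7, k8, k9⟩ := hturn E' hE'
    constructor
    · by_contra! hc
      rcases hc.lt_or_eq with hc | hc
      · linarith [hL E' hE' _ h1 hc]
      · rw [hc] at h4; linarith
    · by_contra! hc
      rcases hc.lt_or_eq with hc | hc
      · linarith [hR E' hE' _ h2 hc]
      · rw [← hc] at h5; linarith
  have hint : ∀ E ∈ J, α < a E ∧ b E < β := by
    intro E hE
    obtain ⟨E', hE', hJ'⟩ := Filter.nonempty_of_mem (Filter.inter_mem (self_mem_nhdsWithin (s := Ioi E))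
      (mem_nhdsWithin_of_mem_nhds (hJopen.mem_nhds hE)))
    obtain ⟨m1, m2⟩ := hmono E hE E' hJ' hE'
    obtain ⟨k1, k2, _⟩ := hturn E' hJ'
    exact ⟨k1.1.trans_lt m1, m2.trans_le k2.2⟩
  -- analyticity of the turning points
  have hab : ∀ E ∈ J, AnalyticAt ℝ a E ∧ AnalyticAt ℝ b E := by
    intro E hE
    obtain ⟨h1, h2, h3, h4, h5, h6, h7, h8, h9⟩ := hturn E hE
    obtain ⟨i1, i2⟩ := hint E hE
    obtain ⟨g, g1, g2, g3⟩ := local_inv (hVan _ h1) h8.ne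
    obtain ⟨k, k1, k2, k3⟩ := local_inv (hVan _ h2) h9.ne'
    rw [h4] at g1 g2 g3
    rw [h5] at k1 k2 k3
    obtain ⟨m, hm1, hm2⟩ := exists_between h3
    have e1 : ∀ᶠ x in 𝓝 E, g x ∈ Ioo α m := g1.continuousAt.eventually_mem (by
      rw [g2]; exact Ioo_mem_nhds i1 hm1)
    have e2 : ∀ᶠ x in 𝓝 E, k x ∈ Ioo m β := k1.continuousAt.eventually_mem (by
      rw [k2]; exact Ioo_mem_nhds hm2 i2)
    have key : ∀ᶠ x in 𝓝 E, g x = a x ∧ k x = b x := by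
      filter_upwards [e1, e2, g3, k3, hJopen.mem_nhds hE] with x x1 x2 x3 x4 x5
      obtain ⟨-, -, l3, -, -, l6, -⟩ := hturn x x5
      have y1 := l6 (g x) ⟨x1.1.le, by linarith [x1.2, h2.2]⟩ x3
      have y2 := l6 (k x) ⟨by linarith [x2.1, h1.1], x2.2.le⟩ x4
      have y3 : g x < k x := x1.2.trans x2.1
      rcases y1 with y1 | y1 <;> rcases y2 with y2 | y2
      · linarith
      · exact ⟨y1, y2⟩
      · linarith
      · linarith
    exact ⟨g1.congr (key.mono fun x hx => hx.1), k1.congr (key.mono fun x hx => hx.2)⟩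
  -- double divided difference
  obtain ⟨G, hG⟩ := hadamard_div (P := ℝ) (fun x => V x.2) univ α β (fun p _ y hy =>
    AnalyticAt.fun_comp (f := fun x : ℝ × ℝ => x.2) (x := (p, y)) (hVan y hy) analyticAt_snd)
  obtain ⟨H, hH⟩ := hadamard_div (P := ℝ) (fun x => G (0, x.1, x.2)) (Icc α β) α β (fun p hp y hy =>
    AnalyticAt.fun_comp (f := fun x : ℝ × ℝ => ((0:ℝ), x.1, x.2)) (x := (p, y))
      (hG 0 trivial p hp y hy).1 (analyticAt_const.prod (analyticAt_fst.prod analyticAt_snd)))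
  have hfac : ∀ E ∈ J, ∀ t ∈ Icc α β, E - V t = (t - a E) * (b E - t) * H (a E, b E, t) := by
    intro E hE t ht
    obtain ⟨h1, h2, h3, h4, h5, h6, h7, h8, h9⟩ := hturn E hE
    have e1 := (hG 0 trivial _ h1 _ ht).2
    have e2 := (hG 0 trivial _ h1 _ h2).2
    have e3 := (hH _ h1 _ h2 _ ht).2
    simp only at e1 e2 e3
    rw [h4, h5, sub_self] at e2
    have e4 : G (0, a E, b E) = 0 := by
      rcases mul_eq_zero.1 e2.symm with h | h
      · linarith
      · exact h
    rw [e4, sub_zero] at e3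
    rw [e3, h4] at e1
    linear_combination -e1
  have hHpos : ∀ E ∈ J, ∀ t ∈ Icc (a E) (b E), 0 < H (a E, b E, t) := by
    intro E hE t ht
    obtain ⟨h1, h2, h3, h4, h5, h6, h7, h8, h9⟩ := hturn E hE
    obtain ⟨i1, i2⟩ := hint E hE
    have hder : ∀ x ∈ Ioo α β, deriv V x = - ((b E - x) * H (a E, b E, x)) +
        (x - a E) * H (a E, b E, x) - (x - a E) * (b E - x) * deriv (fun t => H (a E, b E, t)) x := by
      intro x hx
      have d1 : AnalyticAt ℝ (fun t => H (a E, b E, t)) x :=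
        AnalyticAt.fun_comp (f := fun t : ℝ => (a E, b E, t)) (x := x)
          (hH _ h1 _ h2 x ⟨hx.1.le, hx.2.le⟩).1
          (analyticAt_const.prod (analyticAt_const.prod analyticAt_id))
      have d2 := d1.differentiableAt.hasDerivAt
      have d3 := ((((hasDerivAt_id x).sub_const (a E)).mul ((hasDerivAt_id x).const_sub (b E))).mul d2).const_sub E
      have d4 : V =ᶠ[𝓝 x] fun t => E - (t - a E) * (b E - t) * H (a E, b E, t) := by
        filter_upwards [Ioo_mem_nhds hx.1 hx.2] with t ht
        rw [← hfac E hE t ⟨ht.1.le, ht.2.le⟩]; ring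
      rw [d4.deriv_eq]
      refine d3.deriv.trans ?_
      simp only [id, Pi.mul_apply]
      ring
    rcases ht.1.eq_or_lt with h | h
    · have := hder (a E) ⟨i1, h3.trans i2⟩
      rw [← h]
      rw [this] at h8
      simp only [sub_self, zero_mul, add_zero, sub_zero] at h8
      by_contra! hc
      nlinarith
    rcases ht.2.eq_or_lt with h' | h'
    · have := hder (b E) ⟨i1.trans h3, i2⟩
      rw [h']
      rw [this] at h9
      simp only [sub_self, zero_mul, neg_zero, zero_add, mul_zero, sub_zero] at h9
      exact (mul_pos_iff_of_pos_left (by linarith)).1 h9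
    · have e := hfac E hE t ⟨h1.1.trans ht.1, ht.2.trans h2.2⟩
      have e1 := h7 t ⟨h, h'⟩
      have e2 : 0 < (t - a E) * (b E - t) := mul_pos (by linarith) (by linarith)
      exact (mul_pos_iff_of_pos_left e2).1 (by rw [← e]; linarith)
  have hform : ∀ E ∈ J, 𝒜 E = (b E - a E) ^ 2 * ∫ u in (0:ℝ)..1, Real.sqrt (u * (1 - u)) *
      Real.sqrt (H (a E, b E, a E + (b E - a E) * u)) := by
    intro E hE
    obtain ⟨h1, h2, h3, h4, h5, h6, h7, h8, h9⟩ := hturn E hE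
    have := intervalIntegral.smul_integral_comp_add_mul (a := 0) (b := 1) (fun t => Real.sqrt (E - V t))
      (b E - a E) (a E)
    simp only [mul_zero, add_zero, mul_one, add_sub_cancel] at this
    rw [h𝒜, ← this, smul_eq_mul, sq, mul_assoc]
    congr 1
    rw [← intervalIntegral.integral_const_mul]
    refine intervalIntegral.integral_congr fun u hu => ?_
    rw [uIcc_of_le zero_le_one] at hu
    have hba : 0 < b E - a E := by linarith
    have hm : a E + (b E - a E) * u ∈ Icc (a E) (b E) := ⟨by nlinarith [hu.1], by nlinarith [hu.2]⟩
    have e := hfac E hE (a E + (b E - a E) * u) ⟨h1.1.trans hm.1, hm.2.trans h2.2⟩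
    have e' : E - V (a E + (b E - a E) * u) = (b E - a E) ^ 2 * ((u * (1 - u)) *
      H (a E, b E, a E + (b E - a E) * u)) := by rw [e]; ring
    beta_reduce
    rw [e', Real.sqrt_mul (sq_nonneg _), Real.sqrt_sq hba.le,
      Real.sqrt_mul (mul_nonneg hu.1 (by linarith [hu.2]))]
  intro E hE
  obtain ⟨h1, h2, h3, h4, h5, h6, h7, h8, h9⟩ := hturn E hE
  obtain ⟨i1, i2⟩ := hint E hE
  obtain ⟨aA, bA⟩ := hab E hE
  have hAn : AnalyticAt ℝ 𝒜 E := by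
    have p1 : AnalyticAt ℝ (fun y => ∫ u in (0:ℝ)..1, Real.sqrt (u * (1 - u)) *
      Real.sqrt (H (a y, b y, a y + (b y - a y) * u))) E := by
      refine param_analytic (P := ℝ) (fun x => Real.sqrt (H (a x.1, b x.1, a x.1 + (b x.1 - a x.1) * x.2)))
        (fun u => Real.sqrt (u * (1 - u))) (by fun_prop) E fun u hu => ?_
      have hba : 0 < b E - a E := by linarith
      have hm : a E + (b E - a E) * u ∈ Icc (a E) (b E) := ⟨by nlinarith [hu.1], by nlinarith [hu.2]⟩
      have a1 : AnalyticAt ℝ (fun x : ℝ × ℝ => a x.1) (E, u) :=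
        AnalyticAt.fun_comp (f := fun x : ℝ × ℝ => x.1) (x := (E, u)) aA analyticAt_fst
      have b1 : AnalyticAt ℝ (fun x : ℝ × ℝ => b x.1) (E, u) :=
        AnalyticAt.fun_comp (f := fun x : ℝ × ℝ => x.1) (x := (E, u)) bA analyticAt_fst
      have c1 : AnalyticAt ℝ (fun x : ℝ × ℝ => a x.1 + (b x.1 - a x.1) * x.2) (E, u) :=
        a1.add ((b1.sub a1).mul analyticAt_snd)
      have d1 := AnalyticAt.fun_comp (f := fun x : ℝ × ℝ => (a x.1, b x.1, a x.1 + (b x.1 - a x.1) * x.2))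
        (x := (E, u)) (hH _ h1 _ h2 _ ⟨h1.1.trans hm.1, hm.2.trans h2.2⟩).1 (a1.prod (b1.prod c1))
      exact AnalyticAt.fun_comp (f := fun x : ℝ × ℝ => H (a x.1, b x.1, a x.1 + (b x.1 - a x.1) * x.2))
        (x := (E, u)) (sqrt_analyticAt (hHpos E hE _ hm)) d1
    refine (((bA.sub aA).pow 2).mul p1).congr ?_
    filter_upwards [hJopen.mem_nhds hE] with y hy
    rw [hform y hy]; rfl
  have hsub : Icc (a E) (b E) ⊆ Icc α β := Icc_subset_Icc h1.1 h2.2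
  -- integrability
  have hInt : IntervalIntegrable (fun t => 1 / Real.sqrt (E - V t)) volume (a E) (b E) := by
    obtain ⟨t₀, ht₀, hmin⟩ := isCompact_Icc.exists_isMinOn (nonempty_Icc.2 h3.le)
      (f := fun t => H (a E, b E, t)) (fun t ht => by
        have d1 : AnalyticAt ℝ (fun t => H (a E, b E, t)) t :=
          AnalyticAt.fun_comp (f := fun t : ℝ => (a E, b E, t)) (x := t)
          (hH _ h1 _ h2 t (hsub ht)).1
          (analyticAt_const.prod (analyticAt_const.prod analyticAt_id))
        exact d1.continuousAt.continuousWithinAt)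
    have hc := hHpos E hE t₀ ht₀
    set c := H (a E, b E, t₀)
    refine ((inv_sqrt_integrable h3).const_mul (1 / (Real.sqrt (b E - a E) * Real.sqrt c))).mono_fun ?_ ?_
    · have : ContinuousOn (fun t => 1 / Real.sqrt (E - V t)) (Ioo (a E) (b E)) := by
        refine continuousOn_const.div ((continuousOn_const.sub (hVc.mono (Ioo_subset_Icc_self.trans hsub))).sqrt) ?_
        intro t ht
        exact (Real.sqrt_pos.2 (by linarith [h7 t ht])).ne'
      rw [uIoc_of_le h3.le, ← Measure.restrict_congr_set Ioo_ae_eq_Ioc]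
      exact this.aestronglyMeasurable measurableSet_Ioo
    · rw [uIoc_of_le h3.le, ← Measure.restrict_congr_set Ioo_ae_eq_Ioc]
      refine (ae_restrict_iff' measurableSet_Ioo).2 (ae_of_all _ fun t ht => ?_)
      have x0 : 0 < t - a E := by linarith [ht.1]
      have y0 : 0 < b E - t := by linarith [ht.2]
      have e := hfac E hE t (hsub ⟨ht.1.le, ht.2.le⟩)
      have hm : c ≤ H (a E, b E, t) := hmin ⟨ht.1.le, ht.2.le⟩
      have bd := inv_sqrt_bound x0 y0
      rw [show t - a E + (b E - t) = b E - a E by ring] at bd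
      have s1 : 0 < Real.sqrt ((t - a E) * (b E - t)) := Real.sqrt_pos.2 (mul_pos x0 y0)
      have s2 : 0 < Real.sqrt c := Real.sqrt_pos.2 hc
      have s3 : 0 < Real.sqrt (b E - a E) := Real.sqrt_pos.2 (by linarith)
      beta_reduce
      have s4 : 0 < (t - a E) ^ (-(1/2) : ℝ) := Real.rpow_pos_of_pos x0 _
      have s5 : 0 < (b E - t) ^ (-(1/2) : ℝ) := Real.rpow_pos_of_pos y0 _
      rw [Real.norm_of_nonneg (by positivity), Real.norm_of_nonneg (by positivity), e,
        Real.sqrt_mul (mul_pos x0 y0).le]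
      calc 1 / (Real.sqrt ((t - a E) * (b E - t)) * Real.sqrt (H (a E, b E, t)))
          ≤ 1 / (Real.sqrt ((t - a E) * (b E - t)) * Real.sqrt c) := by gcongr
        _ = 1 / Real.sqrt ((t - a E) * (b E - t)) * (1 / Real.sqrt c) := by field_simp
        _ ≤ ((t - a E) ^ (-(1/2) : ℝ) + (b E - t) ^ (-(1/2) : ℝ)) / Real.sqrt (b E - a E) *
            (1 / Real.sqrt c) := by gcongr
        _ = _ := by field_simp
  have hInt2 : IntervalIntegrable (fun t => 1 / (2 * Real.sqrt (E - V t))) volume (a E) (b E) := by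
    have := hInt.const_mul (1/2)
    refine this.congr (fun t _ => ?_)
    beta_reduce
    rw [div_mul_div_comm, one_mul]
  refine ⟨hAn, hInt2, ?_, ?_⟩
  · have hd := hAn.differentiableAt.hasDerivAt
    have hslope := (hasDerivAt_iff_tendsto_slope.1 hd).mono_left (nhdsLT_le_nhdsNE E)
    have hcI : ∀ y, ContinuousOn (fun t => Real.sqrt (y - V t)) (Icc α β) := fun y =>
      (continuousOn_const.sub hVc).sqrt
    have hii : ∀ y, ∀ c ∈ Icc α β, ∀ d ∈ Icc α β,
        IntervalIntegrable (fun t => Real.sqrt (y - V t)) volume c d := fun y c hc d hd =>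
      ((hcI y).mono (uIcc_subset_Icc hc hd)).intervalIntegrable
    have hlim : Tendsto (fun y => ∫ t in (a E)..(b E),
        (Real.sqrt (y - V t) - Real.sqrt (E - V t)) / (y - E)) (𝓝[<] E)
        (𝓝 (∫ t in (a E)..(b E), 1 / (2 * Real.sqrt (E - V t)))) := by
      have hne : ∀ᵐ t : ℝ, t ≠ b E := by
        simp [ae_iff]
      refine intervalIntegral.tendsto_integral_filter_of_dominated_convergence
        (fun t => 1 / Real.sqrt (E - V t)) ?_ ?_ hInt ?_
      · refine Eventually.of_forall fun y => ?_
        rw [uIoc_of_le h3.le]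
        exact (((hii y _ h1 _ h2).sub (hii E _ h1 _ h2)).div_const (y - E)).aestronglyMeasurable
      · filter_upwards [self_mem_nhdsWithin] with y hy
        filter_upwards [hne] with t ht1 ht
        rw [uIoc_of_le h3.le] at ht
        have hx := h7 t ⟨ht.1, lt_of_le_of_ne ht.2 ht1⟩
        have := sqrt_slope_bound (x := E - V t) (y := y - V t) (by linarith) (by linarith [mem_Iio.1 hy])
        rw [sub_sub_sub_cancel_right] at this
        exact this
      · filter_upwards [hne] with t ht1 ht
        rw [uIoc_of_le h3.le] at ht
        have hx := h7 t ⟨ht.1, lt_of_le_of_ne ht.2 ht1⟩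
        have hd1 : HasDerivAt (fun y => Real.sqrt (y - V t)) (1 / (2 * Real.sqrt (E - V t))) E :=
          ((hasDerivAt_id E).sub_const (V t)).sqrt (by simp only [id]; linarith)
        have := (hasDerivAt_iff_tendsto_slope.1 hd1).mono_left (nhdsLT_le_nhdsNE E)
        refine this.congr fun y => ?_
        rw [slope_def_field]
    have heq : (fun y => ∫ t in (a E)..(b E),
        (Real.sqrt (y - V t) - Real.sqrt (E - V t)) / (y - E)) =ᶠ[𝓝[<] E] slope 𝒜 E := by
      filter_upwards [self_mem_nhdsWithin, mem_nhdsWithin_of_mem_nhds (hJopen.mem_nhds hE)] with y hy hyJ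
      obtain ⟨k1, k2, k3, k4, k5, k6, k7, k8, k9⟩ := hturn y hyJ
      obtain ⟨m1, m2⟩ := hmono y hyJ E hE hy
      rw [slope_def_field, intervalIntegral.integral_div,
        intervalIntegral.integral_sub (hii y _ h1 _ h2) (hii E _ h1 _ h2), h𝒜 E, h𝒜 y]
      congr 2
      rw [← intervalIntegral.integral_add_adjacent_intervals (hii y _ h1 _ k2) (hii y _ k2 _ h2),
        ← intervalIntegral.integral_add_adjacent_intervals (hii y _ h1 _ k1) (hii y _ k1 _ k2)]
      have z1 : ∫ t in (a E)..(a y), Real.sqrt (y - V t) = 0 := by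
        refine (intervalIntegral.integral_congr (g := fun _ => 0) fun t ht => ?_).trans (by simp)
        rw [uIcc_of_le m1.le] at ht
        refine Real.sqrt_eq_zero_of_nonpos ?_
        rcases ht.2.eq_or_lt with h | h
        · rw [h, k4, sub_self]
        · linarith [hL y hyJ t ⟨h1.1.trans ht.1, ht.2.trans k1.2⟩ h]
      have z2 : ∫ t in (b y)..(b E), Real.sqrt (y - V t) = 0 := by
        refine (intervalIntegral.integral_congr (g := fun _ => 0) fun t ht => ?_).trans (by simp)
        rw [uIcc_of_le m2.le] at ht
        refine Real.sqrt_eq_zero_of_nonpos ?_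
        rcases ht.1.eq_or_lt with h | h
        · rw [← h, k5, sub_self]
        · linarith [hR y hyJ t ⟨k2.1.trans ht.1, ht.2.trans h2.2⟩ h]
      rw [z1, z2]; ring
    rw [tendsto_nhds_unique (hlim.congr' heq) hslope]
    exact hd
  · refine intervalIntegral.intervalIntegral_pos_of_pos_on hInt2 (fun t ht => ?_) h3
    have := Real.sqrt_pos.2 (sub_pos.2 (h7 t ht))
    positivity
end

section
/- Let b < 0 < c be real numbers, let φ : [b, c] → ℝ and g : [b, c] → ℂ be C^∞ functions, and assume φ(t) > φ(0) for every t ∈ [b, c] with t ≠ 0, φ'(0) = 0 and φ''(0) > 0. Then there exist C > 0 and h₀ > 0 such that for all h ∈ (0, h₀]: |∫_{b}^{c} g(t) e^{−φ(t)/h} dt − √(2πh/φ''(0)) · g(0) · e^{−φ(0)/h}| ≤ C h e^{−φ(0)/h}. -/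
open Set MeasureTheory in
lemma lap_core (f : ℝ → ℂ) (g0 : ℂ) (a k h A : ℝ) (ha : 0 < a) (hk : 0 < k) (hh : 0 < h)
    (hf : Integrable f)
    (hfb : ∀ t, ‖f t - g0 * (Real.exp (-(a * t ^ 2) / h) : ℂ)‖ ≤ A * (|t| * Real.exp (-(k * t ^ 2) / h))) :
    ‖(∫ t, f t) - g0 * (Real.sqrt (Real.pi * h / a) : ℂ)‖ ≤ A * (h / k) := by
  have e1 : ∀ q t : ℝ, -(q * t ^ 2) / h = -(q / h) * t ^ 2 := by intro q t; ring
  simp only [e1] at hfb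
  have hak : 0 < a / h := by positivity
  have hkk : 0 < k / h := by positivity
  have i1 : Integrable (fun t : ℝ => g0 * (Real.exp (-(a / h) * t ^ 2) : ℂ)) :=
    (integrable_exp_neg_mul_sq hak).ofReal.const_mul g0
  have v1 : ∫ t : ℝ, g0 * (Real.exp (-(a / h) * t ^ 2) : ℂ) = g0 * (Real.sqrt (Real.pi * h / a) : ℂ) := by
    have e2 : ∫ t : ℝ, (Real.exp (-(a / h) * t ^ 2) : ℂ) = ((∫ t : ℝ, Real.exp (-(a / h) * t ^ 2) : ℝ) : ℂ) :=
      integral_ofReal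
    rw [integral_const_mul, e2, integral_gaussian]
    congr 3
    field_simp
  have i2 : Integrable (fun t : ℝ => |t| * Real.exp (-(k / h) * t ^ 2)) := by
    have := (integrable_mul_exp_neg_mul_sq hkk).norm
    refine this.congr (Filter.Eventually.of_forall fun t => ?_)
    simp
  have v2 : ∫ t : ℝ, |t| * Real.exp (-(k / h) * t ^ 2) = h / k := by
    have := integral_comp_abs (f := fun t : ℝ => t * Real.exp (-(k / h) * t ^ 2))
    simp only [sq_abs] at this
    rw [this]
    have h3 := integral_rpow_mul_exp_neg_mul_rpow (p := 2) (q := 1) (b := k / h)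
      (by norm_num) (by norm_num) hkk
    norm_num [Real.rpow_neg_one] at h3
    have h4 : ∀ x : ℝ, -(k / h * x ^ 2) = -(k / h) * x ^ 2 := fun x => by ring
    simp only [h4] at h3
    rw [h3]; ring
  rw [← v1, ← integral_sub hf i1]
  calc _ ≤ ∫ t : ℝ, A * (|t| * Real.exp (-(k / h) * t ^ 2)) :=
        norm_integral_le_of_norm_le (i2.const_mul A) (Filter.Eventually.of_forall hfb)
    _ = _ := by rw [integral_const_mul, v2]

lemma lap_exp (x y z : ℝ) (hx : z ≤ x) (hy : z ≤ y) :
    |Real.exp (-x) - Real.exp (-y)| ≤ |x - y| * Real.exp (-z) := by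
  wlog hxy : x ≤ y generalizing x y
  · rw [abs_sub_comm, abs_sub_comm x y]; exact this y x hy hx (by linarith)
  have h1 : Real.exp (-y) ≤ Real.exp (-x) := Real.exp_le_exp.2 (by linarith)
  rw [abs_of_nonneg (by linarith), abs_of_nonpos (by linarith)]
  have h2 : Real.exp (-y) = Real.exp (-x) * Real.exp (x - y) := by rw [← Real.exp_add]; ring_nf
  have h3 := Real.add_one_le_exp (x - y)
  have h4 : Real.exp (-x) ≤ Real.exp (-z) := Real.exp_le_exp.2 (by linarith)
  have h5 := Real.exp_pos (-x)
  calc _ = Real.exp (-x) * (1 - Real.exp (x - y)) := by rw [h2]; ring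
    _ ≤ Real.exp (-x) * (y - x) := mul_le_mul_of_nonneg_left (by linarith) h5.le
    _ ≤ Real.exp (-z) * (y - x) := by
        apply mul_le_mul_of_nonneg_right h4; linarith
    _ = _ := by ring

lemma lap_pow (b c : ℝ) (hb : b < 0) (hc : 0 < c) (f f' : ℝ → ℝ) (K : ℝ) (n : ℕ)
    (hK : 0 ≤ K)
    (hd : ∀ t ∈ Set.Icc b c, HasDerivWithinAt f (f' t) (Set.Icc b c) t)
    (hf' : ∀ t ∈ Set.Icc b c, |f' t| ≤ K * |t| ^ n) (h0 : f 0 = 0) :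
    ∀ t ∈ Set.Icc b c, |f t| ≤ K * |t| ^ (n + 1) := by
  intro t ht
  have h0m : (0:ℝ) ∈ Set.Icc b c := ⟨hb.le, hc.le⟩
  have hsub : Set.uIcc 0 t ⊆ Set.Icc b c := Set.uIcc_subset_Icc h0m ht
  have := Convex.norm_image_sub_le_of_norm_hasDerivWithin_le (f := f) (f' := f')
    (s := Set.uIcc 0 t) (C := K * |t| ^ n) (x := 0) (y := t)
    (fun x hx => (hd x (hsub hx)).mono hsub)
    (fun x hx => by
      refine (hf' x (hsub hx)).trans ?_
      have : |x| ≤ |t| := by simpa using Set.abs_sub_left_of_mem_uIcc hx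
      gcongr) (convex_uIcc 0 t) Set.left_mem_uIcc Set.right_mem_uIcc
  simpa [h0, pow_succ, mul_assoc] using this

lemma lap_lip {E : Type*} [NormedAddCommGroup E] [NormedSpace ℝ E]
    (b c : ℝ) (hb : b < 0) (hc : 0 < c) (f : ℝ → E) (hf : ContDiffOn ℝ 1 f (Set.Icc b c)) :
    ∃ K : ℝ, 0 ≤ K ∧ ∀ t ∈ Set.Icc b c, ‖f t - f 0‖ ≤ K * |t| := by
  obtain ⟨K, hK⟩ := hf.exists_lipschitzOnWith one_ne_zero (convex_Icc b c) isCompact_Icc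
  refine ⟨K, K.2, fun t ht => ?_⟩
  simpa using hK.norm_sub_le ht ⟨hb.le, hc.le⟩

lemma lap_taylor (b c : ℝ) (hb : b < 0) (hc : 0 < c) (φ : ℝ → ℝ)
    (hφ : ContDiffOn ℝ (⊤ : ℕ∞) φ (Set.Icc b c)) (hφ' : deriv φ 0 = 0) :
    ∃ K : ℝ, 0 ≤ K ∧ ∀ t ∈ Set.Icc b c,
      |φ t - φ 0 - deriv (deriv φ) 0 / 2 * t ^ 2| ≤ K * |t| ^ 3 := by
  set s := Set.Icc b c with hs
  have hu : UniqueDiffOn ℝ s := uniqueDiffOn_Icc (by linarith)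
  have hnb : s ∈ nhds (0:ℝ) := Icc_mem_nhds hb hc
  have c1 : ContDiffOn ℝ (⊤ : ℕ∞) (derivWithin φ s) s := hφ.derivWithin hu (by simp)
  have c2 : ContDiffOn ℝ (⊤ : ℕ∞) (derivWithin (derivWithin φ s) s) s := c1.derivWithin hu (by simp)
  have d0 : derivWithin φ s 0 = 0 := by rw [derivWithin_of_mem_nhds hnb, hφ']
  have d1 : derivWithin (derivWithin φ s) s 0 = deriv (deriv φ) 0 := by
    rw [derivWithin_of_mem_nhds hnb]
    apply Filter.EventuallyEq.deriv_eq
    filter_upwards [eventually_mem_nhds_iff.2 hnb] with x hx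
    exact derivWithin_of_mem_nhds hx
  obtain ⟨K, hK, hL⟩ := lap_lip b c hb hc _ (c2.of_le (by simp))
  rw [d1] at hL
  refine ⟨K, hK, ?_⟩
  have s1 := lap_pow b c hb hc (fun t => derivWithin φ s t - deriv (deriv φ) 0 * t)
    (fun t => derivWithin (derivWithin φ s) s t - deriv (deriv φ) 0) K 1 hK
    (fun t ht => by
      have := ((c1.differentiableOn (by simp)) t ht).hasDerivWithinAt
      have h2 := this.sub ((hasDerivWithinAt_id t s).const_mul (deriv (deriv φ) 0))
      rw [mul_one] at h2
      exact h2)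
    (by simpa using hL) (by simp [d0])
  refine lap_pow b c hb hc (fun t => φ t - φ 0 - deriv (deriv φ) 0 / 2 * t ^ 2) _ K 2 hK
    (fun t ht => ?_) s1 (by simp)
  have := ((hφ.differentiableOn (by simp)) t ht).hasDerivWithinAt
  have h2 := (this.sub_const (φ 0)).sub
    (((hasDerivWithinAt_id t s).pow 2).const_mul (deriv (deriv φ) 0 / 2))
  refine h2.congr_deriv ?_
  simp; ring

lemma lap_lower (b c : ℝ) (hb : b < 0) (hc : 0 < c) (ψ : ℝ → ℝ) (a K : ℝ) (ha : 0 < a)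
    (hcont : ContinuousOn ψ (Set.Icc b c)) (hpos : ∀ t ∈ Set.Icc b c, t ≠ 0 → 0 < ψ t)
    (h0 : ψ 0 = 0) (hK : 0 ≤ K)
    (hT : ∀ t ∈ Set.Icc b c, |ψ t - a * t ^ 2| ≤ K * |t| ^ 3) :
    ∃ m > 0, m ≤ a ∧ ∀ t ∈ Set.Icc b c, m * t ^ 2 ≤ ψ t := by
  have h0m : (0:ℝ) ∈ Set.Icc b c := ⟨hb.le, hc.le⟩
  set q : ℝ → ℝ := fun t => if t = 0 then a else ψ t / t ^ 2 with hq
  have hq0 : q 0 = a := by simp [hq]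
  have hqn : ∀ t, t ≠ 0 → q t = ψ t / t ^ 2 := fun t ht => by simp [hq, ht]
  have hqc : ContinuousOn q (Set.Icc b c) := by
    intro t ht
    by_cases h : t = 0
    · subst h
      rw [ContinuousWithinAt, hq0, tendsto_iff_norm_sub_tendsto_zero]
      have hlim : Filter.Tendsto (fun t : ℝ => K * |t|) (nhdsWithin 0 (Set.Icc b c)) (nhds 0) := by
        have : Continuous (fun t : ℝ => K * |t|) := by fun_prop
        simpa using (this.tendsto 0).mono_left nhdsWithin_le_nhds
      refine squeeze_zero' (Filter.Eventually.of_forall fun t => norm_nonneg _) ?_ hlim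
      filter_upwards [self_mem_nhdsWithin] with t ht
      by_cases h : t = 0
      · subst h; simp [hq0]
      · have h2 : 0 < |t| := abs_pos.2 h
        have : q t - a = (ψ t - a * t ^ 2) / t ^ 2 := by rw [hqn t h]; field_simp
        rw [this, Real.norm_eq_abs, abs_div, abs_of_pos (by positivity : 0 < t ^ 2),
          div_le_iff₀ (by positivity)]
        have := hT t ht
        linarith [show K * |t| ^ 3 = K * |t| * t ^ 2 by rw [← sq_abs t]; ring]
    · have h1 : ContinuousWithinAt (fun t => ψ t / t ^ 2) (Set.Icc b c) t :=
        (hcont t ht).div (by fun_prop) (by positivity)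
      refine h1.congr_of_eventuallyEq ?_ (hqn t h)
      filter_upwards [mem_nhdsWithin_of_mem_nhds (isOpen_ne.mem_nhds h)] with x hx
      exact hqn x hx
  obtain ⟨x, hx, hmin⟩ := isCompact_Icc.exists_isMinOn ⟨0, h0m⟩ hqc
  refine ⟨q x, ?_, by simpa [hq0] using hmin h0m, fun t ht => ?_⟩
  · by_cases h : x = 0
    · rw [h, hq0]; exact ha
    · rw [hqn x h]; have := hpos x hx h; positivity
  · by_cases h : t = 0
    · simp [h, h0]
    · have : q x ≤ q t := hmin ht
      rw [hqn t h, le_div_iff₀ (by positivity)] at this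
      exact this

lemma lap_final (b c : ℝ) (hb : b < 0) (hc : 0 < c) (ψ : ℝ → ℝ) (g : ℝ → ℂ) (a : ℝ) (ha : 0 < a)
    (hcψ : ContinuousOn ψ (Set.Icc b c)) (hcg : ContinuousOn g (Set.Icc b c))
    (K L m : ℝ) (hK : 0 ≤ K) (hL : 0 ≤ L) (hm : 0 < m) (hma : m ≤ a)
    (hT : ∀ t ∈ Set.Icc b c, |ψ t - a * t ^ 2| ≤ K * |t| ^ 3)
    (hG : ∀ t ∈ Set.Icc b c, ‖g t - g 0‖ ≤ L * |t|)
    (hlow : ∀ t ∈ Set.Icc b c, m * t ^ 2 ≤ ψ t) :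
    ∃ C > (0:ℝ), ∀ h > 0,
      ‖(∫ t in b..c, g t * (Real.exp (-ψ t / h) : ℂ)) - g 0 * (Real.sqrt (Real.pi * h / a) : ℂ)‖
        ≤ C * h := by
  set r := min (-b) c with hr
  have hr0 : 0 < r := lt_min (by linarith) hc
  set A := L + ‖g 0‖ * K * (2 / m) + ‖g 0‖ / r with hA
  have hA0 : 0 ≤ A := by positivity
  refine ⟨A / (m / 2) + 1, by positivity, fun h hh => ?_⟩
  set F : ℝ → ℂ := fun t => g t * (Real.exp (-ψ t / h) : ℂ) with hF
  have hFc : ContinuousOn F (Set.Icc b c) := by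
    have : ContinuousOn (fun t => Real.exp (-ψ t / h)) (Set.Icc b c) :=
      Real.continuous_exp.comp_continuousOn (hcψ.neg.div_const h)
    exact hcg.mul (Complex.continuous_ofReal.comp_continuousOn this)
  have hFi : MeasureTheory.IntegrableOn F (Set.Ioc b c) :=
    hFc.integrableOn_Icc.mono_set Set.Ioc_subset_Icc_self
  rw [intervalIntegral.integral_of_le (by linarith),
    ← MeasureTheory.integral_indicator measurableSet_Ioc]
  have key := lap_core (Set.indicator (Set.Ioc b c) F) (g 0) a (m / 2) h A ha (by positivity) hh
    ((MeasureTheory.integrable_indicator_iff measurableSet_Ioc).2 hFi) ?_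
  · refine key.trans ?_
    have : A * (h / (m / 2)) = A / (m / 2) * h := by ring
    rw [this]; nlinarith
  intro t
  have hE := Real.exp_pos (-(m / 2 * t ^ 2) / h)
  set E := Real.exp (-(m / 2 * t ^ 2) / h) with hEdef
  by_cases ht : t ∈ Set.Ioc b c
  · rw [Set.indicator_of_mem ht]
    have ht' := Set.Ioc_subset_Icc_self ht
    have e1 : Real.exp (-ψ t / h) ≤ E := by
      apply Real.exp_le_exp.2
      apply div_le_div_of_nonneg_right _ hh.le
      nlinarith [hlow t ht', sq_nonneg t]
    have e2 : |Real.exp (-ψ t / h) - Real.exp (-(a * t ^ 2) / h)| ≤ K * (2 / m) * |t| * E := by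
      have h1 := lap_exp (ψ t / h) (a * t ^ 2 / h) (m * t ^ 2 / h)
        (div_le_div_of_nonneg_right (hlow t ht') hh.le)
        (div_le_div_of_nonneg_right (by gcongr) hh.le)
      rw [← neg_div, ← neg_div, ← sub_div, abs_div, abs_of_pos hh] at h1
      have h2 : m / 2 * t ^ 2 / h ≤ Real.exp (m / 2 * t ^ 2 / h) := by
        linarith [Real.add_one_le_exp (m / 2 * t ^ 2 / h)]
      have h3 : Real.exp (m / 2 * t ^ 2 / h) * Real.exp (-(m * t ^ 2 / h)) = E := by
        rw [← Real.exp_add, hEdef]; congr 1; ring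
      have hp := Real.exp_pos (-(m * t ^ 2 / h))
      calc _ ≤ _ := h1
        _ ≤ K * |t| ^ 3 / h * Real.exp (-(m * t ^ 2 / h)) := by
            gcongr; exact hT t ht'
        _ = K * (2 / m) * |t| * ((m / 2 * t ^ 2 / h) * Real.exp (-(m * t ^ 2 / h))) := by
            rw [← sq_abs t]; field_simp
        _ ≤ K * (2 / m) * |t| * (Real.exp (m / 2 * t ^ 2 / h) * Real.exp (-(m * t ^ 2 / h))) := by
            gcongr
        _ = _ := by rw [h3]
    have e3 : F t - g 0 * (Real.exp (-(a * t ^ 2) / h) : ℂ) =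
        (g t - g 0) * (Real.exp (-ψ t / h) : ℂ) +
          g 0 * ((Real.exp (-ψ t / h) - Real.exp (-(a * t ^ 2) / h) : ℝ) : ℂ) := by
      rw [Complex.ofReal_sub]; simp only [hF]; ring
    rw [e3]
    calc _ ≤ _ := norm_add_le _ _
      _ = ‖g t - g 0‖ * Real.exp (-ψ t / h) +
          ‖g 0‖ * |Real.exp (-ψ t / h) - Real.exp (-(a * t ^ 2) / h)| := by
          rw [norm_mul, norm_mul, Complex.norm_real, Complex.norm_real, Real.norm_eq_abs,
            Real.norm_eq_abs, abs_of_pos (Real.exp_pos _)]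
      _ ≤ L * |t| * E + ‖g 0‖ * (K * (2 / m) * |t| * E) := by
          gcongr; exact hG t ht'
      _ ≤ L * |t| * E + ‖g 0‖ * (K * (2 / m) * |t| * E) + ‖g 0‖ / r * (|t| * E) :=
          le_add_of_nonneg_right (by positivity)
      _ = _ := by rw [hA]; ring
  · rw [Set.indicator_of_notMem ht, zero_sub, norm_neg, norm_mul, Complex.norm_real,
      Real.norm_eq_abs, abs_of_pos (Real.exp_pos _)]
    have hrt : r ≤ |t| := by
      by_contra hcon
      push Not at hcon
      have h1 := hcon.trans_le (min_le_left _ _)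
      have h2 := hcon.trans_le (min_le_right _ _)
      exact ht ⟨by linarith [neg_abs_le t], by linarith [le_abs_self t]⟩
    have e1 : Real.exp (-(a * t ^ 2) / h) ≤ E := by
      apply Real.exp_le_exp.2
      apply div_le_div_of_nonneg_right _ hh.le
      nlinarith [sq_nonneg t]
    calc _ ≤ ‖g 0‖ * E := by gcongr
      _ = ‖g 0‖ / r * (r * E) := by field_simp
      _ ≤ ‖g 0‖ / r * (|t| * E) := by gcongr
      _ ≤ A * (|t| * E) := by
          gcongr
          rw [hA]
          exact le_add_of_nonneg_left (by positivity)

/-- Laplace's method for an interior nondegenerate minimum: if `φ` is smooth on `[b,c]`,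
attains its strict global minimum only at the interior point `0`, with `φ'(0) = 0` and
`φ''(0) > 0`, and `g` is a smooth complex amplitude, then
`∫_b^c g(t) e^{−φ(t)/h} dt = √(2πh/φ''(0)) g(0) e^{−φ(0)/h} + O(h e^{−φ(0)/h})`. -/
theorem laplace_method_interior_minimum
    (b c : ℝ) (hb : b < 0) (hc : 0 < c)
    (φ : ℝ → ℝ) (g : ℝ → ℂ)
    (hφ : ContDiffOn ℝ (⊤ : ℕ∞) φ (Set.Icc b c)) (hg : ContDiffOn ℝ (⊤ : ℕ∞) g (Set.Icc b c))
    (hmin : ∀ t ∈ Set.Icc b c, t ≠ 0 → φ 0 < φ t)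
    (hφ' : deriv φ 0 = 0) (hφ'' : 0 < deriv (deriv φ) 0) :
    ∃ C > (0 : ℝ), ∃ h₀ > (0 : ℝ), ∀ h ∈ Set.Ioc (0 : ℝ) h₀,
      ‖(∫ t in b..c, g t * Complex.exp (-(φ t : ℂ) / (h : ℂ))) -
          (Real.sqrt (2 * Real.pi * h / deriv (deriv φ) 0) : ℂ) * g 0 *
            Complex.exp (-(φ 0 : ℂ) / (h : ℂ))‖ ≤
        C * h * Real.exp (-(φ 0) / h) := by
  obtain ⟨K, hK, hT⟩ := lap_taylor b c hb hc φ hφ hφ'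
  obtain ⟨L, hL, hG⟩ := lap_lip b c hb hc g (hg.of_le (by simp))
  have ha : 0 < deriv (deriv φ) 0 / 2 := by positivity
  have hcψ : ContinuousOn (fun t => φ t - φ 0) (Set.Icc b c) := hφ.continuousOn.sub continuousOn_const
  obtain ⟨m, hm, hma, hlow⟩ := lap_lower b c hb hc (fun t => φ t - φ 0) _ K ha hcψ
    (fun t ht h => sub_pos.2 (hmin t ht h)) (by simp) hK hT
  obtain ⟨C, hC, hfin⟩ := lap_final b c hb hc (fun t => φ t - φ 0) g _ ha hcψ hg.continuousOn
    K L m hK hL hm hma hT hG hlow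
  refine ⟨C, hC, 1, one_pos, fun h hh => ?_⟩
  have hf := hfin h hh.1
  have e0 : Complex.exp (-(φ 0 : ℂ) / (h : ℂ)) = (Real.exp (-(φ 0) / h) : ℂ) := by
    push_cast; rfl
  have e1 : (∫ t in b..c, g t * Complex.exp (-(φ t : ℂ) / (h : ℂ))) =
      (∫ t in b..c, g t * (Real.exp (-(φ t - φ 0) / h) : ℂ)) * (Real.exp (-(φ 0) / h) : ℂ) := by
    rw [← intervalIntegral.integral_mul_const]
    congr 1
    funext t
    rw [mul_assoc, ← Complex.ofReal_mul, ← Real.exp_add]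
    push_cast
    congr 2
    ring
  have e2 : 2 * Real.pi * h / deriv (deriv φ) 0 = Real.pi * h / (deriv (deriv φ) 0 / 2) := by
    field_simp
  rw [e0, e1, e2, mul_comm _ (g 0), ← sub_mul, norm_mul, Complex.norm_real, Real.norm_eq_abs,
    abs_of_pos (Real.exp_pos _)]
  exact mul_le_mul_of_nonneg_right hf (Real.exp_pos _).le
end
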